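/- arXiv:0910.4639 — 4 statements merged into one kernel-verified Lean document; each statement's English description precedes it below -/
import Mathlib

section
/- For a commutative ring R the following are equivalent: (1) every finitely generated projective submodule of every Gorenstein projective R-module is a direct summand of it; (2) R is a CH-ring, i.e., every finitely generated projective submodule of every projective R-module is a direct summand of it. -/
universe u

/-- An `R`-module `M` is **Gorenstein projective** if there exists an exact complex
`P : ⋯ → P₋₁ → P₀ → P₁ → ⋯` of projective `R`-modules with `M` isomorphic to the image
of `P₀ → P₁`, such that `Hom_R(P, Q)` is exact for every projective `R`-module `Q`. -/
def IsGorensteinProjective (R : Type u) [CommRing R] (M : Type u)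
    [AddCommGroup M] [Module R M] : Prop :=
  ∃ (P : ℤ → ModuleCat.{u} R) (d : ∀ i : ℤ, P i →ₗ[R] P (i + 1)),
    (∀ i, Module.Projective R (P i)) ∧
    (∀ i, LinearMap.range (d i) = LinearMap.ker (d (i + 1))) ∧
    Nonempty (M ≃ₗ[R] LinearMap.range (d 0)) ∧
    (∀ Q : ModuleCat.{u} R, Module.Projective R Q →
      ∀ (i : ℤ) (f : P (i + 1) →ₗ[R] Q), f.comp (d i) = 0 →
        ∃ g : P (i + 1 + 1) →ₗ[R] Q, f = g.comp (d (i + 1)))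

/-- A ring `R` is a **CH-ring** if every finitely generated projective submodule of a
projective `R`-module `P` is a direct summand of `P`. -/
def IsCHRing (R : Type u) [CommRing R] : Prop :=
  ∀ (P : Type u) [AddCommGroup P] [Module R P], Module.Projective R P →
    ∀ N : Submodule R P, N.FG → Module.Projective R N →
      ∃ C : Submodule R P, IsCompl N C

/-- Every projective module `M` is Gorenstein projective, as witnessed by the constant complex
on `M × M` with differential `(x, y) ↦ (y, 0)`. -/
theorem IsGorensteinProjective.of_projective (R : Type u) [CommRing R] (M : Type u)
    [AddCommGroup M] [Module R M] [Module.Projective R M] : IsGorensteinProjective R M := by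
  refine ⟨fun _ => ModuleCat.of R (M × M),
    fun _ => (LinearMap.inl R M M).comp (LinearMap.snd R M M),
    fun _ => inferInstanceAs (Module.Projective R (M × M)), fun _ => ?_, ⟨?_⟩, ?_⟩
  · change LinearMap.range ((LinearMap.inl R M M).comp (LinearMap.snd R M M)) =
      LinearMap.ker ((LinearMap.inl R M M).comp (LinearMap.snd R M M))
    rw [LinearMap.range_comp_of_range_eq_top _ (LinearMap.range_eq_top.2 LinearMap.snd_surjective),
      LinearMap.ker_comp_of_ker_eq_bot _ (LinearMap.ker_eq_bot.2 LinearMap.inl_injective),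
      LinearMap.range_inl]
  · exact (LinearEquiv.ofInjective (LinearMap.inl R M M) LinearMap.inl_injective).trans
      (LinearEquiv.ofEq _ _
        (LinearMap.range_comp_of_range_eq_top _
          (LinearMap.range_eq_top.2 LinearMap.snd_surjective)).symm)
  · intro Q _ _ (f : M × M →ₗ[R] Q) hf
    refine ⟨(f.comp (LinearMap.inr R M M)).comp (LinearMap.fst R M M), ?_⟩
    refine LinearMap.ext fun (p : M × M) => ?_
    have h : f (p.1, 0) = 0 := LinearMap.congr_fun hf ((0, p.1) : M × M)
    change f p = f (0, p.2)
    calc f p = f ((p.1, 0) + (0, p.2)) := by simp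
      _ = f (0, p.2) := by rw [map_add, h, zero_add]

/-- If the image of a submodule `N` under an injective linear map is a direct summand, then so
is `N`. -/
theorem Submodule.exists_isCompl_of_map {R M P : Type*} [Ring R] [AddCommGroup M] [Module R M]
    [AddCommGroup P] [Module R P] (f : M →ₗ[R] P) (hf : Function.Injective f)
    (N : Submodule R M) (h : ∃ C : Submodule R P, IsCompl (N.map f) C) :
    ∃ C : Submodule R M, IsCompl N C := by
  obtain ⟨C, hC⟩ := h
  refine ⟨C.comap f, ?_, ?_⟩
  · rw [Submodule.disjoint_def]
    intro x hx hxC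
    exact hf (by rw [Submodule.disjoint_def.1 hC.disjoint (f x) ⟨x, hx, rfl⟩ hxC, map_zero])
  · rw [codisjoint_iff, eq_top_iff]
    intro x _
    obtain ⟨_, ⟨n, hn, rfl⟩, c, hc, hx⟩ :=
      Submodule.mem_sup.1 (hC.sup_eq_top ▸ Submodule.mem_top : f x ∈ N.map f ⊔ C)
    refine Submodule.mem_sup.2 ⟨n, hn, x - n, ?_, add_sub_cancel n x⟩
    rwa [Submodule.mem_comap, map_sub, ← hx, add_sub_cancel_left]

/-- For a commutative ring `R`: every finitely generated projective submodule of every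
Gorenstein projective `R`-module is a direct summand iff `R` is a CH-ring (every finitely
generated projective submodule of every projective `R`-module is a direct summand). -/
theorem gorensteinProjective_summand_iff_CHRing (R : Type u) [CommRing R] :
    (∀ (G : Type u) [AddCommGroup G] [Module R G], IsGorensteinProjective R G →
      ∀ N : Submodule R G, N.FG → Module.Projective R N →
        ∃ C : Submodule R G, IsCompl N C) ↔
    IsCHRing R := by
  refine ⟨fun h P _ _ _ => h P (.of_projective R P), fun h G _ _ hG N hN hNp => ?_⟩
  obtain ⟨P, d, hP, -, ⟨e⟩, -⟩ := hG
  have hf : Function.Injective ((LinearMap.range (d 0)).subtype.comp e.toLinearMap) :=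
    (Submodule.subtype_injective _).comp e.injective
  exact Submodule.exists_isCompl_of_map _ hf N
    (h _ (hP _) _ (hN.map _) (.of_equiv (Submodule.equivMapOfInjective _ hf N)))
end

section
/- A commutative ring R is Gorenstein semisimple (every R-module is Gorenstein projective) if and only if R is Noetherian and Gorenstein Von Neumann regular (every R-module is Gorenstein flat). -/
universe u

/-- An `R`-module `M` is **Gorenstein flat** if there exists an exact complex
`F : ⋯ → F₋₁ → F₀ → F₁ → ⋯` of flat `R`-modules with `M` isomorphic to the image
of `F₀ → F₁`, such that `I ⊗_R F` is exact for every injective `R`-module `I`. -/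
def IsGorensteinFlat (R : Type u) [CommRing R] (M : Type u)
    [AddCommGroup M] [Module R M] : Prop :=
  ∃ (F : ℤ → ModuleCat.{u} R) (d : ∀ i : ℤ, F i →ₗ[R] F (i + 1)),
    (∀ i, Module.Flat R (F i)) ∧
    (∀ i, LinearMap.range (d i) = LinearMap.ker (d (i + 1))) ∧
    Nonempty (M ≃ₗ[R] LinearMap.range (d 0)) ∧
    (∀ I : ModuleCat.{u} R, Module.Injective R I →
      ∀ i : ℤ, LinearMap.range (LinearMap.lTensor (R := R) (M := I) (d i)) =
        LinearMap.ker (LinearMap.lTensor (R := R) (M := I) (d (i + 1))))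

namespace GorensteinSemisimple

theorem exists_int_chain {α : Type*} (r : α → α → Prop) (hr : ∀ a, ∃ b, r a b)
    (hl : ∀ b, ∃ a, r a b) (a : α) : ∃ Z : ℤ → α, Z 1 = a ∧ ∀ i, r (Z i) (Z (i + 1)) := by
  choose s hs using hr
  choose p hp using hl
  refine ⟨fun i ↦ if 1 ≤ i then s^[(i - 1).toNat] a else p^[(1 - i).toNat] a, by simp,
    fun i ↦ ?_⟩
  rcases lt_trichotomy i 0 with hi | rfl | hi
  · have h₁ : (1 - i).toNat = (1 - (i + 1)).toNat + 1 := by lia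
    simp only [show ¬ 1 ≤ i by lia, show ¬ 1 ≤ i + 1 by lia, if_false, h₁,
      Function.iterate_succ_apply']
    exact hp _
  · simpa using hp a
  · have h₁ : (i + 1 - 1).toNat = (i - 1).toNat + 1 := by lia
    simp only [show 1 ≤ i by lia, show 1 ≤ i + 1 by lia, if_true, h₁,
      Function.iterate_succ_apply']
    exact hs _

theorem exists_comp_eq_of_ker_le_ker {R : Type u} [CommRing R] {A B E : Type u}
    [AddCommGroup A] [Module R A] [AddCommGroup B] [Module R B] [AddCommGroup E] [Module R E]
    [Module.Injective R E] (f : A →ₗ[R] B) (g : A →ₗ[R] E)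
    (h : LinearMap.ker f ≤ LinearMap.ker g) : ∃ k : B →ₗ[R] E, k ∘ₗ f = g := by
  obtain ⟨k, hk⟩ := Module.Injective.out
    ((LinearMap.ker f).liftQ f le_rfl)
    (LinearMap.ker_eq_bot.mp (Submodule.ker_liftQ_eq_bot _ _ _ le_rfl))
    ((LinearMap.ker f).liftQ g h)
  exact ⟨k, LinearMap.ext fun x ↦ by simpa using hk (Submodule.Quotient.mk x)⟩

theorem exists_extension_of_submodule {R : Type u} [CommRing R] {A B E : Type u}
    [AddCommGroup A] [Module R A] [AddCommGroup B] [Module R B] [AddCommGroup E] [Module R E]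
    [Module.Injective R E] (N : Submodule R A) (f : A →ₗ[R] B) (g : A →ₗ[R] E)
    (h : ∀ x ∈ N, f x = 0 → g x = 0) : ∃ k : B →ₗ[R] E, ∀ x ∈ N, k (f x) = g x := by
  obtain ⟨k, hk⟩ := exists_comp_eq_of_ker_le_ker (f ∘ₗ N.subtype) (g ∘ₗ N.subtype)
    fun x hx ↦ h x x.2 hx
  exact ⟨k, fun x hx ↦ LinearMap.congr_fun hk ⟨x, hx⟩⟩

theorem exists_comp_eq_of_surjective {R : Type*} [CommRing R] {A B E : Type*}
    [AddCommGroup A] [Module R A] [AddCommGroup B] [Module R B] [AddCommGroup E] [Module R E]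
    (f : A →ₗ[R] B) (hf : Function.Surjective f) (g : A →ₗ[R] E)
    (h : LinearMap.ker f ≤ LinearMap.ker g) : ∃ k : B →ₗ[R] E, k ∘ₗ f = g := by
  refine ⟨(LinearMap.ker f).liftQ g h ∘ₗ (f.quotKerEquivOfSurjective hf).symm,
    LinearMap.ext fun x ↦ ?_⟩
  have : (f.quotKerEquivOfSurjective hf).symm (f x) = Submodule.Quotient.mk x := by
    rw [LinearEquiv.symm_apply_eq]; rfl
  simp [this]

theorem injective_of_retract {R : Type u} [CommRing R] {P Q : Type u}
    [AddCommGroup P] [Module R P] [AddCommGroup Q] [Module R Q] [Module.Injective R P]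
    (i : Q →ₗ[R] P) (p : P →ₗ[R] Q) (h : p ∘ₗ i = LinearMap.id) : Module.Injective R Q where
  out X Y _ _ _ _ f hf g := by
    obtain ⟨k, hk⟩ := Module.Injective.out f hf (i ∘ₗ g)
    exact ⟨p ∘ₗ k, fun x ↦ by simpa [hk] using LinearMap.congr_fun h (g x)⟩

/-- An injective module which embeds into `P` is a direct summand of `P`. -/
theorem exists_retraction {R : Type u} [CommRing R] {E P : Type u}
    [AddCommGroup E] [Module R E] [AddCommGroup P] [Module R P] [Module.Injective R E]
    (i : E →ₗ[R] P) (hi : Function.Injective i) : ∃ p : P →ₗ[R] E, p ∘ₗ i = LinearMap.id := by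
  obtain ⟨p, hp⟩ := Module.Injective.out i hi LinearMap.id
  exact ⟨p, LinearMap.ext hp⟩

section GorensteinProjective

variable {R : Type u} [CommRing R]

theorem IsGorensteinProjective.exists_embedding {M : Type u} [AddCommGroup M] [Module R M]
    (h : IsGorensteinProjective R M) :
    ∃ (P : ModuleCat.{u} R) (i : M →ₗ[R] P), Module.Projective R P ∧ Function.Injective i := by
  obtain ⟨P, d, hP, -, ⟨e⟩, -⟩ := h
  exact ⟨P (0 + 1), (LinearMap.range (d 0)).subtype ∘ₗ e, hP _,
    (Subtype.val_injective).comp e.injective⟩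

theorem IsGorensteinFlat.exists_embedding {M : Type u} [AddCommGroup M] [Module R M]
    (h : IsGorensteinFlat R M) :
    ∃ (F : ModuleCat.{u} R) (i : M →ₗ[R] F), Module.Flat R F ∧ Function.Injective i := by
  obtain ⟨F, d, hF, -, ⟨e⟩, -⟩ := h
  exact ⟨F (0 + 1), (LinearMap.range (d 0)).subtype ∘ₗ e, hF _,
    (Subtype.val_injective).comp e.injective⟩

/-- Homomorphisms from a first syzygy of a Gorenstein projective module to a projective module
extend to the covering projective module. -/
theorem IsGorensteinProjective.exists_cover {N : Type u} [AddCommGroup N] [Module R N]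
    (h : IsGorensteinProjective R N) :
    ∃ (P : ModuleCat.{u} R) (π : P →ₗ[R] N), Module.Projective R P ∧ Function.Surjective π ∧
      ∀ Q : ModuleCat.{u} R, Module.Projective R Q → ∀ f : LinearMap.ker π →ₗ[R] Q,
        ∃ g : P →ₗ[R] Q, ∀ x : LinearMap.ker π, g x = f x := by
  obtain ⟨P, d, hP, hd, he, hQ⟩ := h
  obtain ⟨i, ⟨e⟩⟩ : ∃ i : ℤ, Nonempty (N ≃ₗ[R] LinearMap.range (d (i + 1 + 1))) := by
    have (j : ℤ) (hj : j = 0) : Nonempty (N ≃ₗ[R] LinearMap.range (d j)) := hj ▸ he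
    exact ⟨-2, this _ (by norm_num)⟩
  have hker : LinearMap.ker (e.symm.toLinearMap ∘ₗ (d (i + 1 + 1)).rangeRestrict) =
      LinearMap.range (d (i + 1)) := by
    rw [hd (i + 1), LinearMap.ker_comp_of_ker_eq_bot _ (LinearEquiv.ker _),
      LinearMap.ker_rangeRestrict]
  refine ⟨P (i + 1 + 1), e.symm.toLinearMap ∘ₗ (d (i + 1 + 1)).rangeRestrict, hP _,
    e.symm.surjective.comp (d (i + 1 + 1)).surjective_rangeRestrict, fun Q hQ' f ↦ ?_⟩
  let c : P (i + 1) →ₗ[R] LinearMap.ker (e.symm.toLinearMap ∘ₗ (d (i + 1 + 1)).rangeRestrict) :=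
    (d (i + 1)).codRestrict _ fun x ↦ hker ▸ LinearMap.mem_range_self (d (i + 1)) x
  have hc : (f ∘ₗ c) ∘ₗ d i = 0 := by
    ext x
    have : d (i + 1) (d i x) = 0 := by
      rw [← LinearMap.mem_ker, ← hd]; exact LinearMap.mem_range_self _ _
    have : c (d i x) = 0 := Subtype.ext this
    simp [this]
  obtain ⟨g, hg⟩ := hQ Q hQ' i (f ∘ₗ c) hc
  refine ⟨g, fun x ↦ ?_⟩
  obtain ⟨x, hx⟩ := x
  obtain ⟨y, rfl⟩ := hker ▸ hx
  exact (LinearMap.congr_fun hg y).symm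

variable (H : ∀ (M : Type u) [AddCommGroup M] [Module R M], IsGorensteinProjective R M)
include H

theorem injective_of_projective (Q : Type u) [AddCommGroup Q] [Module R Q]
    [hQ : Module.Projective R Q] : Module.Injective R Q where
  out X Y _ _ _ _ i hi g := by
    obtain ⟨P, π, hP, hπ, hext⟩ :=
      IsGorensteinProjective.exists_cover (H (Y ⧸ LinearMap.range i))
    obtain ⟨φ, hφ⟩ := Module.projective_lifting_property (LinearMap.range i).mkQ π
      (Submodule.mkQ_surjective _)
    let i' := LinearEquiv.ofInjective i hi
    have hmem (x : LinearMap.ker π) : φ x ∈ LinearMap.range i := by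
      rw [← Submodule.Quotient.mk_eq_zero]
      exact (LinearMap.congr_fun hφ x).trans x.2
    obtain ⟨k, hk⟩ := hext (ModuleCat.of R Q) hQ
      (g ∘ₗ i'.symm.toLinearMap ∘ₗ
        (φ ∘ₗ (LinearMap.ker π).subtype).codRestrict (LinearMap.range i) hmem)
    obtain ⟨h, hh⟩ := exists_comp_eq_of_surjective (i.coprod φ) (fun y ↦ by
        obtain ⟨p, hp⟩ := hπ (Submodule.Quotient.mk y)
        have : (Submodule.Quotient.mk (φ p) : Y ⧸ LinearMap.range i) = Submodule.Quotient.mk y :=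
          (LinearMap.congr_fun hφ p).trans hp
        obtain ⟨x, hx⟩ := (Submodule.Quotient.eq _).mp this.symm
        exact ⟨(x, p), by simp [hx]⟩) (g.coprod k) (fun ⟨x, p⟩ hxp ↦ by
        have hxp : i x + φ p = 0 := by simpa using hxp
        have hφp : φ p = i (-x) := by rw [map_neg]; exact eq_neg_of_add_eq_zero_right hxp
        have hp : p ∈ LinearMap.ker π := by
          rw [LinearMap.mem_ker, ← hφ, LinearMap.comp_apply, Submodule.mkQ_apply,
            Submodule.Quotient.mk_eq_zero, hφp]
          exact LinearMap.mem_range_self _ _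
        have hk' : k p = g (-x) := by
          rw [hk ⟨p, hp⟩]
          simp only [LinearMap.comp_apply]
          congr 1
          change i'.symm _ = _
          rw [LinearEquiv.symm_apply_eq]
          exact Subtype.ext hφp
        simp [hk'])
    exact ⟨h, fun x ↦ by simpa using LinearMap.congr_fun hh (x, 0)⟩

theorem isNoetherianRing : IsNoetherianRing R := by
  classical
  refine monotone_stabilizes_iff_noetherian.mp fun I ↦ ?_
  choose P i hP hi using fun n ↦ IsGorensteinProjective.exists_embedding (H (R ⧸ I n))
  let J : Ideal R := ⨆ n, I n
  have hJ (x : J) : ∃ n, (x : R) ∈ I n :=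
    (Submodule.mem_iSup_of_directed _ I.monotone.directed_le).mp x.2
  let φ (n : ℕ) : R →ₗ[R] P n := i n ∘ₗ (I n).mkQ
  have hφ (n : ℕ) (x : R) : φ n x = 0 ↔ x ∈ I n := by
    simp only [φ, LinearMap.comp_apply, map_eq_zero_iff _ (hi n)]
    exact Submodule.Quotient.mk_eq_zero _
  have hfin (x : J) : {n | φ n x ≠ 0}.Finite := by
    obtain ⟨n, hn⟩ := hJ x
    refine (Set.finite_lt_nat n).subset fun m hm ↦ ?_
    by_contra! hnm
    exact hm ((hφ m x).mpr (I.monotone (not_lt.mp hnm) hn))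
  have hmk (x : J) (n : ℕ) :
      DFinsupp.mk (β := fun n ↦ P n) (hfin x).toFinset (fun n ↦ φ n x) n = φ n x := by
    by_cases hn : φ n x = 0 <;> simp [DFinsupp.mk_apply, hn]
  let ψ : J →ₗ[R] Π₀ n, P n :=
    { toFun x := DFinsupp.mk (hfin x).toFinset fun n ↦ φ n x
      map_add' x y := by
        ext n
        rw [DFinsupp.add_apply, hmk, hmk, hmk, Submodule.coe_add, map_add]
      map_smul' r x := by
        ext n
        rw [RingHom.id_apply, DFinsupp.smul_apply, hmk, hmk, Submodule.coe_smul, map_smul] }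
  have hψ (x : J) (n : ℕ) : ψ x n = φ n x := hmk x n
  have : Module.Injective R (Π₀ n, P n) := injective_of_projective H _
  obtain ⟨k, hk⟩ := Module.Injective.out J.subtype J.injective_subtype ψ
  obtain ⟨n, hn⟩ := (k 1).support.bddAbove
  refine ⟨n + 1, fun m hm ↦ (I.monotone hm).antisymm fun x hx ↦ ?_⟩
  have hxJ : x ∈ J := Submodule.mem_iSup_of_mem m hx
  have h₀ : (k 1) (n + 1) = 0 := by
    by_contra h
    have := hn (Finset.mem_coe.mpr (DFinsupp.mem_support_iff.mpr h))
    lia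
  rw [← hφ, ← hψ ⟨x, hxJ⟩, ← hk]
  simp only [Submodule.subtype_apply]
  rw [← mul_one x, ← smul_eq_mul, map_smul, DFinsupp.smul_apply, h₀, smul_zero]

theorem isGorensteinFlat_of_forall_isGorensteinProjective (M : Type u) [AddCommGroup M]
    [Module R M] : IsGorensteinFlat R M := by
  obtain ⟨P, d, hP, hd, he, -⟩ := H M
  refine ⟨P, d, fun i ↦ inferInstance, hd, he, fun I hI i ↦ ?_⟩
  obtain ⟨Q, j, hQ, hj⟩ := IsGorensteinProjective.exists_embedding (H I)
  obtain ⟨p, hp⟩ := exists_retraction j hj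
  have : Module.Projective R I := .of_split j p hp
  exact (LinearMap.exact_iff.mp
    (Module.Flat.lTensor_exact I (LinearMap.exact_iff.mpr (hd i).symm))).symm

end GorensteinProjective

section DoubleAnnihilator

variable {R : Type u} [CommRing R]

/-- A Noetherian ring in which every ideal equals its double annihilator is self-injective. -/
theorem baer_self_of_double_annihilator [IsNoetherianRing R]
    (h : ∀ (I : Ideal R) (s : R), (∀ r, (∀ t ∈ I, r * t = 0) → r * s = 0) → s ∈ I) :
    Module.Baer R R := by
  have key (I : Ideal R) : ∀ g : I →ₗ[R] R, ∃ c : R, ∀ x : I, g x = c * x := by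
    induction I, IsNoetherian.noetherian I using Submodule.fg_induction with
    | singleton a =>
      intro g
      have ha : a ∈ Ideal.span {a} := Ideal.mem_span_singleton_self a
      have : g ⟨a, ha⟩ ∈ Ideal.span {a} := h _ _ fun r hr ↦ by
        rw [← smul_eq_mul, ← map_smul]
        have : r • (⟨a, ha⟩ : Ideal.span {a}) = 0 := Subtype.ext (hr a ha)
        rw [this, map_zero]
      obtain ⟨c, hc⟩ := Ideal.mem_span_singleton'.mp this
      refine ⟨c, fun x ↦ ?_⟩
      obtain ⟨x, hx⟩ := x
      obtain ⟨r, rfl⟩ := Ideal.mem_span_singleton'.mp hx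
      have : g ⟨r * a, hx⟩ = r • g ⟨a, ha⟩ := by rw [← map_smul]; rfl
      rw [this, ← hc, smul_eq_mul]
      ring
    | sup I J _ _ hI hJ =>
      intro g
      obtain ⟨x, hx⟩ := hI (g ∘ₗ Submodule.inclusion le_sup_left)
      obtain ⟨y, hy⟩ := hJ (g ∘ₗ Submodule.inclusion le_sup_right)
      have hx' (t : R) (ht : t ∈ I) : g ⟨t, le_sup_left (a := I) ht⟩ = x * t := hx ⟨t, ht⟩
      have hy' (t : R) (ht : t ∈ J) : g ⟨t, le_sup_right (a := I) ht⟩ = y * t := hy ⟨t, ht⟩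
      have hxy : x - y ∈ Submodule.annihilator I ⊔ Submodule.annihilator J := by
        refine h _ _ fun r hr ↦ ?_
        have hrI : r ∈ I := h _ _ fun s hs ↦ by
          rw [mul_comm]
          exact hr s (le_sup_left (a := Submodule.annihilator I)
            (Submodule.mem_annihilator.mpr hs))
        have hrJ : r ∈ J := h _ _ fun s hs ↦ by
          rw [mul_comm]
          exact hr s (le_sup_right (a := Submodule.annihilator I)
            (Submodule.mem_annihilator.mpr hs))
        linear_combination hy' r hrJ - hx' r hrI
      obtain ⟨u, hu, w, hw, huw⟩ := Submodule.mem_sup.mp hxy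
      refine ⟨x - u, fun t ↦ ?_⟩
      obtain ⟨t, ht⟩ := t
      obtain ⟨a, ha, b, hb, rfl⟩ := Submodule.mem_sup.mp ht
      have hab : g ⟨a + b, ht⟩ = x * a + y * b := by
        rw [← hx' a ha, ← hy' b hb, ← map_add]; rfl
      have hua : u * a = 0 := Submodule.mem_annihilator.mp hu a ha
      have hwb : w * b = 0 := Submodule.mem_annihilator.mp hw b hb
      rw [hab]
      linear_combination hua - hwb + b * huw
  intro I g
  obtain ⟨c, hc⟩ := key I g
  exact ⟨LinearMap.mulLeft R c, fun x hx ↦ (hc ⟨x, hx⟩).symm⟩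

theorem baer_finsupp [IsNoetherianRing R] (h : Module.Baer R R) (ι : Type*) :
    Module.Baer R (ι →₀ R) := by
  intro I g
  obtain ⟨t, ht⟩ := IsNoetherian.noetherian (⊤ : Submodule R I)
  choose k hk using fun i ↦ h I (Finsupp.lapply i ∘ₗ g)
  classical
  refine ⟨LinearMap.toSpanSingleton R _
    (Finsupp.onFinset (t.biUnion fun x ↦ (g x).support)
      (fun i ↦ if i ∈ t.biUnion fun x ↦ (g x).support then k i 1 else 0) (fun i hi ↦ by
        by_contra hn; exact hi (if_neg hn))),
    fun x hx ↦ ?_⟩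
  ext i
  simp only [LinearMap.toSpanSingleton_apply, Finsupp.smul_apply, Finsupp.onFinset_apply]
  split_ifs with hi
  · rw [← map_smul, smul_eq_mul, mul_one, hk i x hx]
    rfl
  · have : (⊤ : Submodule R I) ≤ LinearMap.ker (Finsupp.lapply i ∘ₗ g) := by
      rw [← ht, Submodule.span_le]
      intro y hy
      by_contra hne
      exact hi (Finset.mem_biUnion.mpr ⟨y, hy, Finsupp.mem_support_iff.mpr hne⟩)
    simpa using (this (Submodule.mem_top (x := ⟨x, hx⟩))).symm

theorem injective_of_projective_of_baer [IsNoetherianRing R] (h : Module.Baer R R)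
    (Q : Type u) [AddCommGroup Q] [Module R Q] [Module.Projective R Q] :
    Module.Injective R Q := by
  obtain ⟨s, hs⟩ := Module.projective_def'.mp ‹Module.Projective R Q›
  have : Module.Injective R (Q →₀ R) := (baer_finsupp h Q).injective
  exact injective_of_retract s _ hs

/-- Every module contains a maximal set of elements generating an independent family of cyclic
submodules. -/
theorem exists_maximal_independent_cyclic (R M : Type*) [CommRing R] [AddCommGroup M]
    [Module R M] :
    ∃ S : Set M, Maximal (fun S : Set M ↦ ∀ c ∈ Finsupp.supported R R S,
      Finsupp.linearCombination R id c = 0 → ∀ m, c m • m = 0) S := by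
  refine zorn_subset {S : Set M | ∀ c ∈ Finsupp.supported R R S,
      Finsupp.linearCombination R id c = 0 → ∀ m, c m • m = 0} fun C hC hchain ↦ ?_
  rcases C.eq_empty_or_nonempty with rfl | hne
  · refine ⟨∅, fun c hc _ m ↦ ?_, by simp⟩
    have : c = 0 := by simpa [Finsupp.supported_empty] using hc
    simp [this]
  · refine ⟨⋃₀ C, fun c hc hc₀ ↦ ?_, fun s hs ↦ Set.subset_sUnion_of_mem hs⟩
    obtain ⟨S, hS, hcS⟩ := DirectedOn.exists_mem_subset_of_finset_subset_biUnion hne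
      (f := fun s : Set M ↦ s) hchain.directedOn
      (s := c.support) (by rwa [← Set.sUnion_eq_biUnion])
    exact hC hS c hcS hc₀

/-- If every cyclic module embeds into a free module, then so does the direct sum of the cyclic
submodules generated by the elements of `M`. -/
theorem exists_projective_map_of_cyclic
    (hcyc : ∀ I : Ideal R, ∃ v : ℕ →₀ R, ∀ r : R, r • v = 0 ↔ r ∈ I)
    (M : Type u) [AddCommGroup M] [Module R M] :
    ∃ (P : ModuleCat.{u} R) (τ : (M →₀ R) →ₗ[R] P), Module.Projective R P ∧
      ∀ c, τ c = 0 ↔ ∀ m, c m • m = 0 := by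
  classical
  choose v hv using fun m : M ↦ hcyc (LinearMap.ker (LinearMap.toSpanSingleton R M m))
  replace hv (m : M) (r : R) : r • v m = 0 ↔ r • m = 0 := by simpa using hv m r
  let τ : (M →₀ R) →ₗ[R] (M →₀ (ℕ →₀ R)) :=
    Finsupp.lsum R fun m ↦ Finsupp.lsingle m ∘ₗ LinearMap.toSpanSingleton R _ (v m)
  have hτ (c : M →₀ R) (m : M) : τ c m = c m • v m := by
    induction c using Finsupp.induction_linear with
    | zero => simp
    | add c c' hc hc' => simp [hc, hc', add_smul]
    | single x r =>
      by_cases hxm : x = m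
      · subst hxm; simp [τ]
      · simp [τ, Finsupp.single_eq_of_ne (Ne.symm hxm)]
  refine ⟨ModuleCat.of R (M →₀ (ℕ →₀ R)), τ,
    inferInstanceAs (Module.Projective R (M →₀ (ℕ →₀ R))), fun c ↦ ?_⟩
  simp_rw [← hv, ← hτ]
  exact DFunLike.ext_iff

/-- If projective modules are injective and every cyclic module embeds into a free module, then
every module embeds into a projective module. -/
theorem exists_embedding_of_cyclic
    (hinj : ∀ (Q : Type u) [AddCommGroup Q] [Module R Q] [Module.Projective R Q],
      Module.Injective R Q)
    (hcyc : ∀ I : Ideal R, ∃ v : ℕ →₀ R, ∀ r : R, r • v = 0 ↔ r ∈ I)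
    (M : Type u) [AddCommGroup M] [Module R M] :
    ∃ (P : ModuleCat.{u} R) (i : M →ₗ[R] P), Module.Projective R P ∧ Function.Injective i := by
  classical
  obtain ⟨P, τ, hP, hτ₀⟩ := exists_projective_map_of_cyclic hcyc M
  let σ : (M →₀ R) →ₗ[R] M := Finsupp.linearCombination R id
  have hσ₀ (c : M →₀ R) (hc : ∀ m, c m • m = 0) : σ c = 0 := by
    simp [σ, Finsupp.linearCombination_apply, Finsupp.sum, hc]
  obtain ⟨S, hS⟩ := exists_maximal_independent_cyclic R M
  have := hinj P
  obtain ⟨φ, hφ⟩ := exists_extension_of_submodule (Finsupp.supported R R S) σ τ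
    fun c hc hc₀ ↦ (hτ₀ c).mpr (hS.prop c hc hc₀)
  refine ⟨P, φ, hP, (injective_iff_map_eq_zero φ).mpr fun m hm ↦ ?_⟩
  have hmS : m ∈ S := by
    refine hS.le_of_ge (y := insert m S) (fun c hc hc₀ ↦ ?_) (Set.subset_insert m S)
      (Set.mem_insert m S)
    have hc' : c.erase m ∈ Finsupp.supported R R S := by
      intro x hx
      have hx : x ≠ m ∧ c x ≠ 0 := by simpa [and_comm] using hx
      exact (hc (Finsupp.mem_support_iff.mpr hx.2)).resolve_left hx.1
    have hsum : c m • m + σ (c.erase m) = 0 := by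
      have := congrArg σ (Finsupp.single_add_erase m c)
      rw [map_add, hc₀] at this
      simpa [σ] using this
    have h₁ : τ (c.erase m) = 0 := by
      rw [← hφ _ hc']
      simpa [hm] using congrArg φ hsum
    have h₂ := (hτ₀ _).mp h₁
    rw [hσ₀ _ h₂, add_zero] at hsum
    intro x
    by_cases hxm : x = m
    · rwa [hxm]
    · simpa [Finsupp.erase_ne hxm] using h₂ x
  have h₁ : τ (Finsupp.single m 1) = 0 := by
    rw [← hφ _ (Finsupp.single_mem_supported R 1 hmS)]
    simpa [σ] using hm
  simpa using (hτ₀ _).mp h₁ m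

/-- If projective modules are injective and every module embeds into a projective module, then
every module is Gorenstein projective. -/
theorem isGorensteinProjective_of_embedding
    (hinj : ∀ (Q : Type u) [AddCommGroup Q] [Module R Q] [Module.Projective R Q],
      Module.Injective R Q)
    (hemb : ∀ (M : Type u) [AddCommGroup M] [Module R M],
      ∃ (P : ModuleCat.{u} R) (i : M →ₗ[R] P), Module.Projective R P ∧ Function.Injective i)
    (M : Type u) [AddCommGroup M] [Module R M] : IsGorensteinProjective R M := by
  obtain ⟨Z, hZ, hstep⟩ := exists_int_chain
    (fun A B : ModuleCat.{u} R ↦ ∃ (X : ModuleCat.{u} R) (f : A →ₗ[R] X) (g : X →ₗ[R] B),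
      Module.Projective R X ∧ Function.Injective f ∧ Function.Surjective g ∧
      LinearMap.range f = LinearMap.ker g)
    (fun A ↦ by
      obtain ⟨P, i, hP, hi⟩ := hemb A
      exact ⟨ModuleCat.of R (P ⧸ LinearMap.range i), P, i, (LinearMap.range i).mkQ, hP, hi,
        Submodule.mkQ_surjective _, (Submodule.ker_mkQ _).symm⟩)
    (fun B ↦ ⟨ModuleCat.of R (LinearMap.ker (Finsupp.linearCombination R (id : B → B))),
      ModuleCat.of R (B →₀ R), (LinearMap.ker _).subtype, Finsupp.linearCombination R id,
      inferInstanceAs (Module.Projective R (B →₀ R)), Subtype.val_injective,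
      Finsupp.linearCombination_id_surjective R B, Submodule.range_subtype _⟩)
    (ModuleCat.of R M)
  choose X f g hX hf hg hfg using hstep
  have hrange (i : ℤ) : LinearMap.range (f (i + 1) ∘ₗ g i) = LinearMap.range (f (i + 1)) :=
    LinearMap.range_comp_of_range_eq_top _ (LinearMap.range_eq_top.mpr (hg i))
  have hexact (i : ℤ) : LinearMap.range (f (i + 1) ∘ₗ g i) =
      LinearMap.ker (f (i + 1 + 1) ∘ₗ g (i + 1)) := by
    rw [hrange, hfg, LinearMap.ker_comp_of_ker_eq_bot _ (LinearMap.ker_eq_bot.mpr (hf _))]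
  refine ⟨X, fun i ↦ f (i + 1) ∘ₗ g i, hX, hexact, ?_, fun Q hQ i u hu ↦ ?_⟩
  · rw [hrange]
    have e : M ≃ₗ[R] Z (0 + 1) := (CategoryTheory.eqToIso (show ModuleCat.of R M = Z (0 + 1) from
      hZ.symm)).toLinearEquiv
    exact ⟨e.trans (LinearEquiv.ofInjective _ (hf _))⟩
  · have := hinj Q
    obtain ⟨k, hk⟩ := exists_comp_eq_of_ker_le_ker (f (i + 1 + 1) ∘ₗ g (i + 1)) u
      (by rw [← hexact, LinearMap.range_le_ker_iff, hu])
    exact ⟨k, hk.symm⟩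

theorem exists_ideal_eq_annihilator_of_isGorensteinFlat [IsNoetherianRing R]
    (H : ∀ (M : Type u) [AddCommGroup M] [Module R M], IsGorensteinFlat R M) (I : Ideal R) :
    ∃ v : ℕ →₀ R, ∀ r : R, r • v = 0 ↔ r ∈ I := by
  obtain ⟨F, i, hF, hi⟩ := IsGorensteinFlat.exists_embedding (H (R ⧸ I))
  have : Module.FinitePresentation R (R ⧸ I) := Module.finitePresentation_of_finite R _
  obtain ⟨k, a, b, hab⟩ := Module.Flat.exists_factorization_of_finitePresentation i
  have ha : Function.Injective a := by
    refine Function.Injective.of_comp (f := b) ?_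
    rw [← LinearMap.coe_comp, ← hab]
    exact hi
  have hinj : Function.Injective (Finsupp.lmapDomain R R (Fin.val : Fin k → ℕ) ∘ₗ a) :=
    (Finsupp.mapDomain_injective Fin.val_injective).comp ha
  refine ⟨(Finsupp.lmapDomain R R Fin.val ∘ₗ a) (Submodule.Quotient.mk 1), fun r ↦ ?_⟩
  rw [← map_smul, map_eq_zero_iff _ hinj, ← Submodule.Quotient.mk_smul, smul_eq_mul, mul_one,
    Submodule.Quotient.mk_eq_zero]

end DoubleAnnihilator

end GorensteinSemisimple

/-- `R` is Gorenstein semisimple iff `R` is a Noetherian Gorenstein Von Neumann regular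
ring. -/
theorem gorensteinSemisimple_iff_noetherian_gorensteinVonNeumannRegular
    (R : Type u) [CommRing R] :
    (∀ (M : Type u) [AddCommGroup M] [Module R M], IsGorensteinProjective R M) ↔
    (IsNoetherianRing R ∧
      ∀ (M : Type u) [AddCommGroup M] [Module R M], IsGorensteinFlat R M) := by
  refine ⟨fun H ↦ ⟨GorensteinSemisimple.isNoetherianRing H,
    GorensteinSemisimple.isGorensteinFlat_of_forall_isGorensteinProjective H⟩, fun ⟨_, H⟩ ↦ ?_⟩
  have hcyc := GorensteinSemisimple.exists_ideal_eq_annihilator_of_isGorensteinFlat H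
  have hinj := GorensteinSemisimple.injective_of_projective_of_baer
    (GorensteinSemisimple.baer_self_of_double_annihilator fun I s hs ↦ by
      obtain ⟨v, hv⟩ := hcyc I
      rw [← hv]
      ext i
      have := hs (v i) fun t ht ↦ by
        simpa [mul_comm] using DFunLike.congr_fun ((hv t).mpr ht) i
      simpa [mul_comm] using this)
  exact GorensteinSemisimple.isGorensteinProjective_of_embedding hinj
    (GorensteinSemisimple.exists_embedding_of_cyclic hinj hcyc)
end

section
/- Let R be a commutative ring and n ≥ 0. If every Gorenstein injective R-module has Gorenstein flat dimension at most n, then every injective R-module has flat dimension at most n. -/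
universe u

/-- An `R`-module `M` is **Gorenstein injective** if there exists an exact complex
`I : ⋯ → I₋₁ → I₀ → I₁ → ⋯` of injective `R`-modules with `M` isomorphic to the image
of `I₀ → I₁`, such that `Hom_R(J, I)` is exact for every injective `R`-module `J`. -/
def IsGorensteinInjective (R : Type u) [CommRing R] (M : Type u)
    [AddCommGroup M] [Module R M] : Prop :=
  ∃ (I : ℤ → ModuleCat.{u} R) (d : ∀ i : ℤ, I i →ₗ[R] I (i + 1)),
    (∀ i, Module.Injective R (I i)) ∧
    (∀ i, LinearMap.range (d i) = LinearMap.ker (d (i + 1))) ∧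
    Nonempty (M ≃ₗ[R] LinearMap.range (d 0)) ∧
    (∀ J : ModuleCat.{u} R, Module.Injective R J →
      ∀ (i : ℤ) (f : J →ₗ[R] I (i + 1)), (d (i + 1)).comp f = 0 →
        ∃ g : J →ₗ[R] I i, f = (d i).comp g)

/-- Auxiliary: flat dimension at most `n`, phrased recursively on objects of `ModuleCat R`:
`fd ≤ 0` means flat, and `fd ≤ n+1` means there is a surjection from a flat module whose
kernel has flat dimension at most `n` (i.e. there is an exact sequence
`0 → F_n → ⋯ → F_0 → M → 0` with every `F_i` flat). -/
def flatDimLEAux (R : Type u) [CommRing R] : ℕ → ModuleCat.{u} R → Prop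
  | 0, M => Module.Flat R M
  | n + 1, M => ∃ (F : ModuleCat.{u} R) (f : F →ₗ[R] M),
      Function.Surjective f ∧ Module.Flat R F ∧
      flatDimLEAux R n (ModuleCat.of R (LinearMap.ker f))

/-- The flat dimension of the `R`-module `M` is at most `n`. -/
def FlatDimLE (R : Type u) [CommRing R] (n : ℕ) (M : Type u)
    [AddCommGroup M] [Module R M] : Prop :=
  flatDimLEAux R n (ModuleCat.of R M)

/-- Auxiliary: Gorenstein flat dimension at most `n`, phrased recursively: `Gfd ≤ 0` means
Gorenstein flat, and `Gfd ≤ n+1` means there is a surjection from a Gorenstein flat module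
whose kernel has Gorenstein flat dimension at most `n` (i.e. there is an exact sequence
`0 → G_n → ⋯ → G_0 → M → 0` with every `G_i` Gorenstein flat). -/
def gorensteinFlatDimLEAux (R : Type u) [CommRing R] : ℕ → ModuleCat.{u} R → Prop
  | 0, M => IsGorensteinFlat R M
  | n + 1, M => ∃ (G : ModuleCat.{u} R) (f : G →ₗ[R] M),
      Function.Surjective f ∧ IsGorensteinFlat R G ∧
      gorensteinFlatDimLEAux R n (ModuleCat.of R (LinearMap.ker f))

/-- The Gorenstein flat dimension of the `R`-module `M` is at most `n`. -/
def GorensteinFlatDimLE (R : Type u) [CommRing R] (n : ℕ) (M : Type u)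
    [AddCommGroup M] [Module R M] : Prop :=
  gorensteinFlatDimLEAux R n (ModuleCat.of R M)

open CategoryTheory Abelian

/-- The maps `f` and `g` form a short exact sequence `0 → A → B → C → 0`. -/
structure IsShortExact {R : Type u} [CommRing R] {A B C : Type u} [AddCommGroup A] [Module R A]
    [AddCommGroup B] [Module R B] [AddCommGroup C] [Module R C]
    (f : A →ₗ[R] B) (g : B →ₗ[R] C) : Prop where
  inj : Function.Injective f
  surj : Function.Surjective g
  exact : Function.Exact f g

namespace IsShortExact

section Maps

variable {R : Type u} [CommRing R] {A B C M : Type u} [AddCommGroup A] [Module R A]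
  [AddCommGroup B] [Module R B] [AddCommGroup C] [Module R C] [AddCommGroup M] [Module R M]
  {f : A →ₗ[R] B} {g : B →ₗ[R] C}

lemma apply_apply (h : IsShortExact f g) (a : A) : g (f a) = 0 := h.exact.apply_apply_eq_zero a

lemma exists_lift (h : IsShortExact f g) (φ : M →ₗ[R] B) (hφ : ∀ m, g (φ m) = 0) :
    ∃ ψ : M →ₗ[R] A, ∀ m, f (ψ m) = φ m := by
  have hr : ∀ m, φ m ∈ LinearMap.range f := fun m => (h.exact (φ m)).1 (hφ m)
  refine ⟨(LinearEquiv.ofInjective f h.inj).symm.toLinearMap ∘ₗ φ.codRestrict _ hr, fun m => ?_⟩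
  exact congrArg Subtype.val
    ((LinearEquiv.ofInjective f h.inj).apply_symm_apply (φ.codRestrict _ hr m))

lemma exists_desc (h : IsShortExact f g) (φ : B →ₗ[R] M) (hφ : ∀ a, φ (f a) = 0) :
    ∃ ψ : C →ₗ[R] M, ∀ b, ψ (g b) = φ b := by
  have hk : LinearMap.ker g ≤ LinearMap.ker φ := by
    intro b hb
    obtain ⟨a, rfl⟩ := (h.exact b).1 hb
    exact hφ a
  refine ⟨(LinearMap.ker g).liftQ φ hk ∘ₗ (g.quotKerEquivOfSurjective h.surj).symm.toLinearMap,
    fun b => ?_⟩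
  have : (g.quotKerEquivOfSurjective h.surj).symm (g b) = (LinearMap.ker g).mkQ b := by
    rw [LinearEquiv.symm_apply_eq]; rfl
  simp [this]

lemma of_ker {g : B →ₗ[R] C} (hg : Function.Surjective g) :
    IsShortExact (LinearMap.ker g).subtype g :=
  ⟨Subtype.val_injective, hg, LinearMap.exact_subtype_ker_map g⟩

lemma of_mkQ {f : A →ₗ[R] B} (hf : Function.Injective f) :
    IsShortExact f (LinearMap.range f).mkQ :=
  ⟨hf, Submodule.mkQ_surjective _, LinearMap.exact_map_mkQ_range f⟩

lemma inl_snd (R A C : Type u) [CommRing R] [AddCommGroup A] [Module R A] [AddCommGroup C]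
    [Module R C] : IsShortExact (LinearMap.inl R A C) (LinearMap.snd R A C) :=
  ⟨LinearMap.inl_injective, LinearMap.snd_surjective, Function.Exact.inl_snd⟩

lemma dual (h : IsShortExact f g) :
    IsShortExact (CharacterModule.dual g) (CharacterModule.dual f) := by
  refine ⟨CharacterModule.dual_injective_of_surjective _ h.surj,
    CharacterModule.dual_surjective_of_injective _ h.inj, fun φ => ⟨fun hφ => ?_, ?_⟩⟩
  · have hk : ∀ b, g b = 0 → φ b = 0 := fun b hb => by
      obtain ⟨a, rfl⟩ := (h.exact b).1 hb
      exact DFunLike.congr_fun hφ a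
    choose s hs using h.surj
    have key : ∀ b c, g b = c → φ (s c) = φ b := fun b c hbc => by
      rw [← sub_eq_zero, ← map_sub]
      exact hk _ (by rw [map_sub, hs, hbc, sub_self])
    refine ⟨AddMonoidHom.mk' (fun c => φ (s c)) fun c c' => ?_, ?_⟩
    · rw [← map_add]
      exact key _ _ (by rw [map_add, hs, hs])
    · ext b
      exact key b _ rfl
  · rintro ⟨ψ, rfl⟩
    ext a
    exact (congrArg ψ (h.apply_apply a)).trans (map_zero ψ)

end Maps

section Ext

variable {R : Type u} [CommRing R] {A B C : ModuleCat.{u} R} {f : A →ₗ[R] B} {g : B →ₗ[R] C}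

/-- The short complex in `ModuleCat R` attached to a short exact sequence of linear maps. -/
abbrev toShortComplex (h : IsShortExact f g) : ShortComplex (ModuleCat.{u} R) :=
  ShortComplex.mk (ModuleCat.ofHom f) (ModuleCat.ofHom g)
    (by ext a; exact h.apply_apply a)

lemma shortExact (h : IsShortExact f g) : h.toShortComplex.ShortExact :=
  ModuleCat.shortComplex_shortExact _ h.exact h.inj h.surj

lemma ext_right_succ (h : IsShortExact f g) {N : ModuleCat.{u} R} {n : ℕ}
    (h₁ : Subsingleton (Ext A N n)) (h₂ : Subsingleton (Ext B N (n + 1))) :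
    Subsingleton (Ext C N (n + 1)) := by
  refine subsingleton_of_forall_eq 0 fun x => ?_
  obtain ⟨y, rfl⟩ := Ext.contravariant_sequence_exact₃ h.shortExact N x
    (Subsingleton.elim _ _) (add_comm 1 n)
  rw [Subsingleton.elim y 0, Ext.comp_zero]

lemma ext_right_one (h : IsShortExact f g) {N : ModuleCat.{u} R}
    (h₁ : ∀ φ : A →ₗ[R] N, ∃ ψ : B →ₗ[R] N, ∀ a, ψ (f a) = φ a)
    (h₂ : Subsingleton (Ext B N 1)) : Subsingleton (Ext C N 1) := by
  refine subsingleton_of_forall_eq 0 fun x => ?_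
  obtain ⟨y, rfl⟩ := Ext.contravariant_sequence_exact₃ h.shortExact N x
    (Subsingleton.elim _ _) (add_comm 1 0)
  obtain ⟨φ, rfl⟩ := Ext.addEquiv₀.symm.surjective y
  obtain ⟨ψ, hψ⟩ := h₁ φ.hom
  have : φ = ModuleCat.ofHom f ≫ ModuleCat.ofHom ψ := by ext a; exact (hψ a).symm
  rw [this, Ext.addEquiv₀_symm_apply, ← Ext.mk₀_comp_mk₀]
  exact h.shortExact.extClass_comp_assoc _

lemma ext_middle (h : IsShortExact f g) {N : ModuleCat.{u} R} {n : ℕ}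
    (h₁ : Subsingleton (Ext N A n)) (h₂ : Subsingleton (Ext N C n)) :
    Subsingleton (Ext N B n) := by
  refine subsingleton_of_forall_eq 0 fun x => ?_
  obtain ⟨y, rfl⟩ := Ext.covariant_sequence_exact₂ N h.shortExact x (Subsingleton.elim _ _)
  rw [Subsingleton.elim y 0, Ext.zero_comp]

lemma ext_right (h : IsShortExact f g) {N : ModuleCat.{u} R} {n : ℕ}
    (h₁ : Subsingleton (Ext N A (n + 1))) (h₂ : Subsingleton (Ext N B n)) :
    Subsingleton (Ext N C n) := by
  refine subsingleton_of_forall_eq 0 fun x => ?_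
  obtain ⟨y, rfl⟩ := Ext.covariant_sequence_exact₃ N h.shortExact x rfl (Subsingleton.elim _ _)
  rw [Subsingleton.elim y 0, Ext.zero_comp]

lemma ext_left_succ (h : IsShortExact f g) {N : ModuleCat.{u} R} {n : ℕ}
    (h₁ : Subsingleton (Ext N C n)) (h₂ : Subsingleton (Ext N B (n + 1))) :
    Subsingleton (Ext N A (n + 1)) := by
  refine subsingleton_of_forall_eq 0 fun x => ?_
  obtain ⟨y, rfl⟩ := Ext.covariant_sequence_exact₁ N h.shortExact x (Subsingleton.elim _ _) rfl
  rw [Subsingleton.elim y 0, Ext.zero_comp]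

lemma ext_left_one (h : IsShortExact f g) {N : ModuleCat.{u} R}
    (h₁ : ∀ φ : N →ₗ[R] C, ∃ ψ : N →ₗ[R] B, ∀ x, g (ψ x) = φ x)
    (h₂ : Subsingleton (Ext N B 1)) : Subsingleton (Ext N A 1) := by
  refine subsingleton_of_forall_eq 0 fun x => ?_
  obtain ⟨y, rfl⟩ := Ext.covariant_sequence_exact₁ N h.shortExact x (Subsingleton.elim _ _)
    (zero_add 1)
  obtain ⟨φ, rfl⟩ := Ext.addEquiv₀.symm.surjective y
  obtain ⟨ψ, hψ⟩ := h₁ φ.hom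
  have : φ = ModuleCat.ofHom ψ ≫ ModuleCat.ofHom g := by ext a; exact (hψ a).symm
  rw [this, Ext.addEquiv₀_symm_apply, ← Ext.mk₀_comp_mk₀,
    Ext.comp_assoc_of_second_deg_zero, h.shortExact.comp_extClass, Ext.comp_zero]

lemma exists_lift_of_ext (h : IsShortExact f g) {N : ModuleCat.{u} R}
    (h₁ : Subsingleton (Ext N A 1)) (φ : N →ₗ[R] C) : ∃ ψ : N →ₗ[R] B, ∀ x, g (ψ x) = φ x := by
  obtain ⟨y, hy⟩ := Ext.covariant_sequence_exact₃ N h.shortExact (Ext.mk₀ (ModuleCat.ofHom φ))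
    (zero_add 1) (Subsingleton.elim _ _)
  obtain ⟨ψ, rfl⟩ := Ext.addEquiv₀.symm.surjective y
  rw [Ext.addEquiv₀_symm_apply, Ext.mk₀_comp_mk₀] at hy
  have := Ext.addEquiv₀.symm.injective hy
  exact ⟨ψ.hom, fun x => congrArg (fun k => k.hom x) this⟩

end Ext

section Injective

variable {R : Type u} [CommRing R]

lemma exists_extension {A B C E : Type u} [AddCommGroup A] [Module R A]
    [AddCommGroup B] [Module R B] [AddCommGroup C] [Module R C] [AddCommGroup E] [Module R E]
    {f : A →ₗ[R] B} {g : B →ₗ[R] C} (h : IsShortExact f g)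
    (hE : Module.Injective R E) (φ : A →ₗ[R] E) : ∃ ψ : B →ₗ[R] E, ∀ a, ψ (f a) = φ a :=
  hE.out f h.inj φ

end Injective

end IsShortExact

lemma subsingleton_ext_of_injective {R : Type u} [CommRing R] (N E : ModuleCat.{u} R)
    (hE : Module.Injective R E) (n : ℕ) : Subsingleton (Ext N E (n + 1)) := by
  have : CategoryTheory.Injective E := Module.injective_object_of_injective_module R E
  exact Ext.subsingleton_of_injective N E n

lemma Module.Injective.of_retract {R : Type u} [CommRing R] {M E : Type u} [AddCommGroup M]
    [Module R M] [AddCommGroup E] [Module R E] (hE : Module.Injective R E)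
    (i : M →ₗ[R] E) (r : E →ₗ[R] M) (hr : ∀ m, r (i m) = m) : Module.Injective R M where
  out X Y _ _ _ _ f hf φ := by
    obtain ⟨ψ, hψ⟩ := hE.out f hf (i ∘ₗ φ)
    exact ⟨r ∘ₗ ψ, fun x => by simp [hψ, hr]⟩

lemma Module.Injective.prod {R : Type u} [CommRing R] {M N : Type u} [AddCommGroup M]
    [Module R M] [AddCommGroup N] [Module R N] (hM : Module.Injective R M)
    (hN : Module.Injective R N) : Module.Injective R (M × N) where
  out X Y _ _ _ _ f hf φ := by
    obtain ⟨ψ, hψ⟩ := hM.out f hf (LinearMap.fst R M N ∘ₗ φ)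
    obtain ⟨χ, hχ⟩ := hN.out f hf (LinearMap.snd R M N ∘ₗ φ)
    exact ⟨ψ.prod χ, fun x => by simp [hψ, hχ]⟩

/-- A class `P` of modules with `Ext¹(J, X) = 0` for `X ∈ P` and `J` injective, each member of
which is the cokernel and the kernel of maps between a member of `P` and an injective module
inside a short exact sequence. The union of all such classes is the class of Gorenstein injective
modules. -/
structure IsGorensteinInjectiveClass {R : Type u} [CommRing R]
    (P : ModuleCat.{u} R → Prop) : Prop where
  ext_one : ∀ X, P X → ∀ J : ModuleCat.{u} R, Module.Injective R J → Subsingleton (Ext J X 1)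
  left : ∀ X, P X → ∃ (A E : ModuleCat.{u} R) (f : A →ₗ[R] E) (g : E →ₗ[R] X),
    IsShortExact f g ∧ Module.Injective R E ∧ P A
  right : ∀ X, P X → ∃ (E C : ModuleCat.{u} R) (f : X →ₗ[R] E) (g : E →ₗ[R] C),
    IsShortExact f g ∧ Module.Injective R E ∧ P C

/-- The module `X` belongs to some Gorenstein injective class. -/
def GInj {R : Type u} [CommRing R] (X : ModuleCat.{u} R) : Prop :=
  ∃ P : ModuleCat.{u} R → Prop, IsGorensteinInjectiveClass P ∧ P X

section GInj

variable {R : Type u} [CommRing R]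

lemma isGorensteinInjectiveClass_gInj :
    IsGorensteinInjectiveClass (GInj : ModuleCat.{u} R → Prop) where
  ext_one := fun X ⟨_, hP, hX⟩ => hP.ext_one X hX
  left := fun X ⟨P, hP, hX⟩ => by
    obtain ⟨A, E, f, g, h, hE, hA⟩ := hP.left X hX
    exact ⟨A, E, f, g, h, hE, P, hP, hA⟩
  right := fun X ⟨P, hP, hX⟩ => by
    obtain ⟨E, C, f, g, h, hE, hC⟩ := hP.right X hX
    exact ⟨E, C, f, g, h, hE, P, hP, hC⟩

lemma gInj_of_injective {X : ModuleCat.{u} R} (hX : Module.Injective R X) : GInj X := by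
  refine ⟨fun X => Module.Injective R X,
    ⟨fun X hX J _ => subsingleton_ext_of_injective J X hX 0, fun X hX => ?_, fun X hX => ?_⟩, hX⟩
  · exact ⟨ModuleCat.of R PUnit, X, 0, LinearMap.id,
      ⟨Function.injective_of_subsingleton _, Function.surjective_id, fun x => by simp [eq_comm]⟩,
      hX, ⟨fun _ _ _ _ _ _ _ _ _ => ⟨0, fun _ => Subsingleton.elim _ _⟩⟩⟩
  · exact ⟨X, ModuleCat.of R PUnit, LinearMap.id, 0,
      ⟨Function.injective_id, Function.surjective_to_subsingleton _, fun x => by simp⟩,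
      hX, ⟨fun _ _ _ _ _ _ _ _ _ => ⟨0, fun _ => Subsingleton.elim _ _⟩⟩⟩

lemma IsShortExact.horseshoe_left {A X C A₁ C₁ E F : Type u} [AddCommGroup A] [Module R A]
    [AddCommGroup X] [Module R X] [AddCommGroup C] [Module R C] [AddCommGroup A₁] [Module R A₁]
    [AddCommGroup C₁] [Module R C₁] [AddCommGroup E] [Module R E] [AddCommGroup F] [Module R F]
    {f : A →ₗ[R] X} {g : X →ₗ[R] C} (h : IsShortExact f g)
    {i : A₁ →ₗ[R] E} {p : E →ₗ[R] A} (hA : IsShortExact i p)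
    {j : C₁ →ₗ[R] F} {q : F →ₗ[R] C} (hC : IsShortExact j q)
    (s : F →ₗ[R] X) (hs : ∀ y, g (s y) = q y) :
    Function.Surjective ((f ∘ₗ p).coprod s) ∧
    ∃ (a : A₁ →ₗ[R] LinearMap.ker ((f ∘ₗ p).coprod s))
      (c : LinearMap.ker ((f ∘ₗ p).coprod s) →ₗ[R] C₁), IsShortExact a c := by
  constructor
  · intro x
    obtain ⟨y, hy⟩ := hC.surj (g x)
    obtain ⟨a, ha⟩ := (h.exact (x - s y)).1 (by rw [map_sub, hs, hy, sub_self])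
    obtain ⟨e, rfl⟩ := hA.surj a
    exact ⟨(e, y), by simp [ha]⟩
  have hmem : ∀ z ∈ LinearMap.ker ((f ∘ₗ p).coprod s), f (p z.1) + s z.2 = 0 := fun z hz => by
    simpa using hz
  obtain ⟨c, hc⟩ := hC.exists_lift
    (LinearMap.snd R E F ∘ₗ (LinearMap.ker ((f ∘ₗ p).coprod s)).subtype) (fun z => by
      have := congrArg g (hmem z z.2)
      simpa [h.apply_apply, hs] using this)
  refine ⟨(LinearMap.inl R E F ∘ₗ i).codRestrict _ (fun a => by simp [hA.apply_apply]), c,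
    fun a b hab => hA.inj (congrArg (fun z => z.1.1) hab), fun y => ?_, fun z => ⟨fun hz => ?_, ?_⟩⟩
  · obtain ⟨a, ha⟩ := (h.exact (s (j y))).1 (by rw [hs, hC.apply_apply])
    obtain ⟨e, rfl⟩ := hA.surj a
    refine ⟨⟨(-e, j y), by simp [ha]⟩, hC.inj ?_⟩
    rw [hc]; rfl
  · have h2 : z.1.2 = 0 := by
      have := hc z
      rw [hz, map_zero] at this
      exact this.symm
    have h1 := hmem z z.2
    rw [h2, map_zero, add_zero] at h1
    obtain ⟨a, ha⟩ := (hA.exact z.1.1).1 (h.inj (by rw [h1, map_zero]))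
    exact ⟨a, Subtype.ext (Prod.ext ha h2.symm)⟩
  · rintro ⟨a, rfl⟩
    exact hC.inj ((hc _).trans (map_zero j).symm)

lemma IsShortExact.horseshoe_right {A X C A₁ C₁ E F : Type u} [AddCommGroup A] [Module R A]
    [AddCommGroup X] [Module R X] [AddCommGroup C] [Module R C] [AddCommGroup A₁] [Module R A₁]
    [AddCommGroup C₁] [Module R C₁] [AddCommGroup E] [Module R E] [AddCommGroup F] [Module R F]
    {f : A →ₗ[R] X} {g : X →ₗ[R] C} (h : IsShortExact f g)
    {i : A →ₗ[R] E} {p : E →ₗ[R] A₁} (hA : IsShortExact i p)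
    {j : C →ₗ[R] F} {q : F →ₗ[R] C₁} (hC : IsShortExact j q)
    (t : X →ₗ[R] E) (ht : ∀ a, t (f a) = i a) :
    Function.Injective (t.prod (j ∘ₗ g)) ∧
    ∃ (a : A₁ →ₗ[R] (E × F) ⧸ LinearMap.range (t.prod (j ∘ₗ g)))
      (c : (E × F) ⧸ LinearMap.range (t.prod (j ∘ₗ g)) →ₗ[R] C₁), IsShortExact a c := by
  have hinj : Function.Injective (t.prod (j ∘ₗ g)) := by
    rw [injective_iff_map_eq_zero]
    intro x hx
    have h1 : t x = 0 := congrArg Prod.fst hx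
    have h2 : j (g x) = 0 := congrArg Prod.snd hx
    obtain ⟨a, rfl⟩ := (h.exact x).1 (hC.inj (by rw [h2, map_zero]))
    rw [hA.inj (a₁ := a) (a₂ := 0) (by rw [← ht, h1, map_zero]), map_zero]
  have hQ := IsShortExact.of_mkQ hinj
  obtain ⟨a, ha⟩ := hA.exists_desc ((LinearMap.range (t.prod (j ∘ₗ g))).mkQ ∘ₗ
    LinearMap.inl R E F) (fun x => (hQ.exact _).2 ⟨f x, by simp [ht, h.apply_apply]⟩)
  obtain ⟨c, hc⟩ := hQ.exists_desc (q ∘ₗ LinearMap.snd R E F) (fun x => by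
    simp [hC.apply_apply])
  refine ⟨hinj, a, c, ?_, fun y => ?_, fun y => ?_⟩
  · rw [injective_iff_map_eq_zero]
    intro y hy
    obtain ⟨e, rfl⟩ := hA.surj y
    rw [ha] at hy
    obtain ⟨x, hx⟩ := (hQ.exact _).1 hy
    have h1 : t x = e := congrArg Prod.fst hx
    have h2 : j (g x) = 0 := congrArg Prod.snd hx
    obtain ⟨b, rfl⟩ := (h.exact x).1 (hC.inj (by rw [h2, map_zero]))
    rw [← h1, ht, hA.apply_apply]
  · obtain ⟨z, rfl⟩ := hC.surj y
    exact ⟨_, hc (0, z)⟩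
  · obtain ⟨⟨e, z⟩, rfl⟩ := hQ.surj y
    rw [hc]
    constructor
    · intro hz
      obtain ⟨w, rfl⟩ := (hC.exact z).1 hz
      obtain ⟨x, rfl⟩ := h.surj w
      refine ⟨p (e - t x), ?_⟩
      rw [ha, ← sub_eq_zero, LinearMap.comp_apply, ← map_sub]
      exact (hQ.exact _).2 ⟨-x, by simp⟩
    · rintro ⟨b, hb⟩
      obtain ⟨e', rfl⟩ := hA.surj b
      rw [ha] at hb
      have := congrArg c hb
      rw [LinearMap.comp_apply, hc, hc] at this
      rw [← this]
      simp

/-- Given `0 → A → B → C → 0` and `0 → A → E → A' → 0` with `E` injective, there is an exact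
sequence `0 → B → E × C → A' → 0`. -/
lemma IsShortExact.exists_prod {A B C E A' : Type u} [AddCommGroup A] [Module R A]
    [AddCommGroup B] [Module R B] [AddCommGroup C] [Module R C] [AddCommGroup E] [Module R E]
    [AddCommGroup A'] [Module R A'] {f : A →ₗ[R] B} {g : B →ₗ[R] C} (h : IsShortExact f g)
    {i : A →ₗ[R] E} {p : E →ₗ[R] A'} (h' : IsShortExact i p) (hE : Module.Injective R E) :
    ∃ (a : B →ₗ[R] E × C) (b : E × C →ₗ[R] A'), IsShortExact a b := by
  obtain ⟨φ, hφ⟩ := h.exists_extension hE i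
  obtain ⟨c, hc⟩ := h.exists_desc (p ∘ₗ φ) (fun a => by simp [hφ, h'.apply_apply])
  refine ⟨φ.prod g, p.coprod (-c), ?_, fun y => ?_, fun y => ⟨fun hy => ?_, ?_⟩⟩
  · rw [injective_iff_map_eq_zero]
    intro x hx
    have h1 : φ x = 0 := congrArg Prod.fst hx
    obtain ⟨a, rfl⟩ := (h.exact x).1 (congrArg Prod.snd hx)
    rw [h'.inj (a₁ := a) (a₂ := 0) (by rw [← hφ, h1, map_zero]), map_zero]
  · obtain ⟨e, rfl⟩ := h'.surj y
    exact ⟨(e, 0), by simp⟩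
  · obtain ⟨e, z⟩ := y
    obtain ⟨x, rfl⟩ := h.surj z
    obtain ⟨a, ha⟩ := (h'.exact (e - φ x)).1 (by simpa [hc, sub_eq_add_neg] using hy)
    refine ⟨x + f a, Prod.ext ?_ ?_⟩
    · simp [hφ, ha]
    · simp [h.apply_apply]
  · rintro ⟨x, rfl⟩
    simp [hc]

lemma gInj_of_isShortExact {A X C : ModuleCat.{u} R} {f : A →ₗ[R] X} {g : X →ₗ[R] C}
    (h : IsShortExact f g) (hA : GInj A) (hC : GInj C) : GInj X := by
  refine ⟨fun X => ∃ (A C : ModuleCat.{u} R) (f : A →ₗ[R] X) (g : X →ₗ[R] C),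
    IsShortExact f g ∧ GInj A ∧ GInj C, ⟨?_, ?_, ?_⟩, A, C, f, g, h, hA, hC⟩
  · rintro X ⟨A, C, f, g, h, hA, hC⟩ J hJ
    exact h.ext_middle (isGorensteinInjectiveClass_gInj.ext_one A hA J hJ)
      (isGorensteinInjectiveClass_gInj.ext_one C hC J hJ)
  · rintro X ⟨A, C, f, g, h, hA, hC⟩
    obtain ⟨A₁, E, i, p, hip, hE, hA₁⟩ := isGorensteinInjectiveClass_gInj.left A hA
    obtain ⟨C₁, F, j, q, hjq, hF, hC₁⟩ := isGorensteinInjectiveClass_gInj.left C hC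
    obtain ⟨s, hs⟩ := h.exists_lift_of_ext
      (isGorensteinInjectiveClass_gInj.ext_one A hA F hF) q
    obtain ⟨hsurj, a, c, hac⟩ := h.horseshoe_left hip hjq s hs
    exact ⟨ModuleCat.of R (LinearMap.ker ((f ∘ₗ p).coprod s)), ModuleCat.of R (E × F), _, _,
      IsShortExact.of_ker hsurj, hE.prod hF, A₁, C₁, a, c, hac, hA₁, hC₁⟩
  · rintro X ⟨A, C, f, g, h, hA, hC⟩
    obtain ⟨E, A₁, i, p, hip, hE, hA₁⟩ := isGorensteinInjectiveClass_gInj.right A hA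
    obtain ⟨F, C₁, j, q, hjq, hF, hC₁⟩ := isGorensteinInjectiveClass_gInj.right C hC
    obtain ⟨t, ht⟩ := h.exists_extension hE i
    obtain ⟨hinj, a, c, hac⟩ := h.horseshoe_right hip hjq t ht
    exact ⟨ModuleCat.of R (E × F), ModuleCat.of R ((E × F) ⧸ LinearMap.range (t.prod (j ∘ₗ g))),
      _, _, IsShortExact.of_mkQ hinj, hE.prod hF, A₁, C₁, a, c, hac, hA₁, hC₁⟩

lemma gInj_prod {A C : ModuleCat.{u} R} (hA : GInj A) (hC : GInj C) :
    GInj (ModuleCat.of R (A × C)) :=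
  gInj_of_isShortExact (IsShortExact.inl_snd R A C) hA hC

lemma gInj_of_prod {E C : ModuleCat.{u} R} (hE : Module.Injective R E)
    (h : GInj (ModuleCat.of R (E × C))) : GInj C := by
  refine ⟨fun C => GInj C ∨ ∃ E : ModuleCat.{u} R, Module.Injective R E ∧
    GInj (ModuleCat.of R (E × C)), ⟨?_, ?_, ?_⟩, Or.inr ⟨E, hE, h⟩⟩
  · rintro C (hC | ⟨E, hE, hEC⟩) J hJ
    · exact isGorensteinInjectiveClass_gInj.ext_one C hC J hJ
    · have hs : IsShortExact (B := ModuleCat.of R (E × C)) (LinearMap.inr R E C)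
          (LinearMap.fst R E C) :=
        ⟨LinearMap.inr_injective, LinearMap.fst_surjective, Function.Exact.inr_fst⟩
      exact hs.ext_left_one (fun φ => ⟨LinearMap.inl R E C ∘ₗ φ, fun _ => rfl⟩)
        (isGorensteinInjectiveClass_gInj.ext_one _ hEC J hJ)
  · rintro C (hC | ⟨E, hE, hEC⟩)
    · obtain ⟨A, F, f, g, h, hF, hA⟩ := isGorensteinInjectiveClass_gInj.left C hC
      exact ⟨A, F, f, g, h, hF, Or.inl hA⟩
    · obtain ⟨K, F, f, g, h, hF, hK⟩ := isGorensteinInjectiveClass_gInj.left _ hEC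
      have hsurj : Function.Surjective (LinearMap.snd R E C ∘ₗ g) :=
        (LinearMap.snd_surjective (R := R) (M := E) (M₂ := C)).comp h.surj
      refine ⟨ModuleCat.of R (LinearMap.ker (LinearMap.snd R E C ∘ₗ g)), F, _, _,
        IsShortExact.of_ker hsurj, hF, Or.inl ?_⟩
      refine gInj_of_isShortExact (A := K) (C := E)
        (f := f.codRestrict _ fun k => by simp [h.apply_apply])
        (g := LinearMap.fst R E C ∘ₗ g ∘ₗ Submodule.subtype _)
        ⟨fun a b hab => h.inj (congrArg Subtype.val hab), fun e => ?_, fun z => ⟨fun hz => ?_, ?_⟩⟩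
        hK (gInj_of_injective hE)
      · obtain ⟨y, hy⟩ := h.surj (e, 0)
        exact ⟨⟨y, by simp [hy]⟩, by simp [hy]⟩
      · obtain ⟨k, hk⟩ := (h.exact z.1).1 (Prod.ext hz z.2)
        exact ⟨k, Subtype.ext hk⟩
      · rintro ⟨k, rfl⟩
        simp [h.apply_apply]
  · rintro C (hC | ⟨E, hE, hEC⟩)
    · obtain ⟨F, D, f, g, h, hF, hD⟩ := isGorensteinInjectiveClass_gInj.right C hC
      exact ⟨F, D, f, g, h, hF, Or.inl hD⟩
    · obtain ⟨F, D, f, g, h, hF, hD⟩ := isGorensteinInjectiveClass_gInj.right _ hEC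
      have hinj : Function.Injective (f ∘ₗ LinearMap.inr R E C) :=
        h.inj.comp LinearMap.inr_injective
      have hQ := IsShortExact.of_mkQ hinj
      refine ⟨F, ModuleCat.of R (F ⧸ LinearMap.range (f ∘ₗ LinearMap.inr R E C)), _, _, hQ, hF,
        Or.inl ?_⟩
      obtain ⟨c, hc⟩ := hQ.exists_desc g (fun x => h.apply_apply _)
      refine gInj_of_isShortExact (A := E) (C := D)
        (f := Submodule.mkQ _ ∘ₗ f ∘ₗ LinearMap.inl R E C) (g := c)
        ⟨?_, fun d => ?_, fun z => ⟨fun hz => ?_, ?_⟩⟩ (gInj_of_injective hE) hD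
      · rw [injective_iff_map_eq_zero]
        intro e he
        obtain ⟨x, hx⟩ := (hQ.exact _).1 he
        exact (congrArg Prod.fst (h.inj hx)).symm
      · obtain ⟨y, rfl⟩ := h.surj d
        exact ⟨_, hc y⟩
      · obtain ⟨y, rfl⟩ := hQ.surj z
        rw [hc] at hz
        obtain ⟨⟨e, x⟩, rfl⟩ := (h.exact y).1 hz
        refine ⟨e, ?_⟩
        rw [← sub_eq_zero, LinearMap.comp_apply, ← map_sub]
        exact (hQ.exact _).2 ⟨-x, by simp [← map_sub, -map_neg]⟩
      · rintro ⟨e, rfl⟩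
        rw [LinearMap.comp_apply, hc]
        exact h.apply_apply _

lemma gInj_cokernel {A B C : ModuleCat.{u} R} {f : A →ₗ[R] B} {g : B →ₗ[R] C}
    (h : IsShortExact f g) (hA : GInj A) (hB : GInj B) : GInj C := by
  obtain ⟨E, A', i, p, hip, hE, hA'⟩ := isGorensteinInjectiveClass_gInj.right A hA
  obtain ⟨a, b, hab⟩ := h.exists_prod hip hE
  exact gInj_of_prod hE (gInj_of_isShortExact (X := ModuleCat.of R (E × C)) hab hB hA')

/-- Gorenstein injective dimension at most `n`: there is an exact sequence
`0 → A → B₀ → ⋯ → Bₙ → 0` of Gorenstein injective modules `Bᵢ`. -/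
def GInjDimLE : ℕ → ModuleCat.{u} R → Prop
  | 0, A => GInj A
  | n + 1, A => ∃ (B C : ModuleCat.{u} R) (f : A →ₗ[R] B) (g : B →ₗ[R] C),
      IsShortExact f g ∧ GInj B ∧ GInjDimLE n C

lemma GInjDimLE.cosyzygy {n : ℕ} {A E A' : ModuleCat.{u} R} {i : A →ₗ[R] E} {p : E →ₗ[R] A'}
    (h' : IsShortExact i p) (hE : Module.Injective R E) (hA : GInjDimLE (n + 1) A) :
    GInjDimLE n A' := by
  obtain ⟨B, C, f, g, h, hB, hC⟩ := hA
  obtain ⟨a, b, hab⟩ := h.exists_prod h' hE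
  cases n with
  | zero =>
    exact gInj_cokernel (B := ModuleCat.of R (E × C)) hab hB
      (gInj_prod (gInj_of_injective hE) hC)
  | succ n =>
    obtain ⟨D, C₂, k, l, hkl, hD, hC₂⟩ := hC
    obtain ⟨m, hm, hm₁, hm₂⟩ : ∃ m : (E × C) →ₗ[R] (E × D), Function.Injective m ∧
        (∀ x, l (m x).2 = 0) ∧ ∀ e w, m (e, w) = (e, k w) :=
      ⟨LinearMap.prodMap LinearMap.id k, Function.Injective.prodMap Function.injective_id hkl.inj,
        fun x => hkl.apply_apply _, fun _ _ => rfl⟩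
    have hQ : IsShortExact (m ∘ₗ a) (LinearMap.range (m ∘ₗ a)).mkQ :=
      IsShortExact.of_mkQ (hm.comp hab.inj)
    obtain ⟨c, hc⟩ := hQ.exists_desc (l ∘ₗ LinearMap.snd R E D) (fun x => hm₁ _)
    obtain ⟨d, hd⟩ := hab.exists_desc ((LinearMap.range (m ∘ₗ a)).mkQ ∘ₗ m)
      (fun x => hQ.apply_apply x)
    refine ⟨ModuleCat.of R ((E × D) ⧸ LinearMap.range (m ∘ₗ a)),
      C₂, d, c, ⟨?_, fun y => ?_, fun y => ⟨fun hy => ?_, ?_⟩⟩,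
      gInj_cokernel (B := ModuleCat.of R (E × D)) hQ hB
        (gInj_prod (gInj_of_injective hE) hD), hC₂⟩
    · rw [injective_iff_map_eq_zero]
      intro y hy
      obtain ⟨z, rfl⟩ := hab.surj y
      rw [hd] at hy
      obtain ⟨x, hx⟩ := (hQ.exact _).1 hy
      rw [← hm hx, hab.apply_apply]
    · obtain ⟨z, rfl⟩ := hkl.surj y
      exact ⟨_, hc (0, z)⟩
    · obtain ⟨⟨e, z⟩, rfl⟩ := hQ.surj y
      rw [hc] at hy
      obtain ⟨w, rfl⟩ := (hkl.exact z).1 hy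
      refine ⟨b (e, w), (hd _).trans ?_⟩
      rw [LinearMap.comp_apply, hm₂]
    · rintro ⟨y, rfl⟩
      obtain ⟨z, rfl⟩ := hab.surj y
      rw [hd, LinearMap.comp_apply, hc]
      exact hm₁ _

end GInj

lemma exists_int_chain {S : Type*} (r : S → S → Prop) (hl : ∀ y, ∃ x, r x y)
    (hr : ∀ x, ∃ y, r x y) (x₀ : S) : ∃ s : ℤ → S, s 1 = x₀ ∧ ∀ i, r (s i) (s (i + 1)) := by
  choose l hl using hl
  choose u hu using hr
  let t : ℤ → S := fun i => match i with
    | Int.ofNat k => u^[k] x₀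
    | Int.negSucc k => l^[k + 1] x₀
  have ht : ∀ i, r (t i) (t (i + 1)) := by
    rintro (k | _ | k)
    · change r (u^[k] x₀) (u^[k + 1] x₀)
      rw [Function.iterate_succ_apply']
      exact hu _
    · exact hl x₀
    · change r (l^[k + 1 + 1] x₀) (l^[k + 1] x₀)
      rw [Function.iterate_succ_apply' l (k + 1)]
      exact hl _
  refine ⟨fun i => t (i - 1), rfl, fun i => ?_⟩
  beta_reduce
  rw [show i + 1 - 1 = i - 1 + 1 by ring]
  exact ht _

section GorensteinInjective

variable {R : Type u} [CommRing R]

lemma GInj.isGorensteinInjective {X : ModuleCat.{u} R} (hX : GInj X) :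
    IsGorensteinInjective R X := by
  have hG := isGorensteinInjectiveClass_gInj (R := R)
  obtain ⟨s, hs₁, hs⟩ := exists_int_chain (S := {X : ModuleCat.{u} R // GInj X})
    (fun X Y => ∃ (E : ModuleCat.{u} R) (f : X.1 →ₗ[R] E) (g : E →ₗ[R] Y.1),
      IsShortExact f g ∧ Module.Injective R E)
    (fun Y => by
      obtain ⟨A, E, f, g, h, hE, hA⟩ := hG.left _ Y.2
      exact ⟨⟨A, hA⟩, E, f, g, h, hE⟩)
    (fun X => by
      obtain ⟨E, C, f, g, h, hE, hC⟩ := hG.right _ X.2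
      exact ⟨⟨C, hC⟩, E, f, g, h, hE⟩) ⟨X, hX⟩
  choose E f g h hE using hs
  refine ⟨E, fun i => f (i + 1) ∘ₗ g i, hE, fun i => ?_, ?_, fun J hJ i φ hφ => ?_⟩
  · rw [LinearMap.range_comp_of_range_eq_top _ (LinearMap.range_eq_top.2 (h i).surj),
      LinearMap.ker_comp_of_ker_eq_bot _ (LinearMap.ker_eq_bot.2 (h (i + 1 + 1)).inj)]
    exact (LinearMap.exact_iff.1 (h (i + 1)).exact).symm
  · rw [LinearMap.range_comp_of_range_eq_top _ (LinearMap.range_eq_top.2 (h 0).surj)]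
    have hX₁ : X = (s (0 + 1)).1 := congrArg Subtype.val hs₁.symm
    subst hX₁
    exact ⟨LinearEquiv.ofInjective _ (h (0 + 1)).inj⟩
  · obtain ⟨ψ, hψ⟩ := (h (i + 1)).exists_lift φ (fun x => (h (i + 1 + 1)).inj (by
      rw [map_zero]; exact LinearMap.congr_fun hφ x))
    obtain ⟨χ, hχ⟩ := (h i).exists_lift_of_ext (hG.ext_one _ (s i).2 J hJ) ψ
    exact ⟨χ, LinearMap.ext fun x => by simp [hχ, hψ]⟩

end GorensteinInjective

section GorensteinFlat

open TensorProduct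

variable {R : Type u} [CommRing R]

/-- If `J ⊗ A → J ⊗ B` is injective, maps `J → A⁺` lift along `B⁺ → A⁺`. -/
lemma exists_lift_dual {A B J : Type u} [AddCommGroup A] [Module R A] [AddCommGroup B]
    [Module R B] [AddCommGroup J] [Module R J] (f : A →ₗ[R] B)
    (hf : Function.Injective (f.lTensor J)) (φ : J →ₗ[R] CharacterModule A) :
    ∃ ψ : J →ₗ[R] CharacterModule B, ∀ x, CharacterModule.dual f (ψ x) = φ x := by
  obtain ⟨c, hc⟩ := CharacterModule.dual_surjective_of_injective _ hf (CharacterModule.uncurry φ)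
  refine ⟨CharacterModule.curry c, fun x => ?_⟩
  ext a
  exact (DFunLike.congr_fun hc (x ⊗ₜ[R] a)).trans rfl

/-- If `J ⊗ A → J ⊗ B` is injective, maps `A → J⁺` extend along `A → B`. -/
lemma exists_extension_dual {A B J : Type u} [AddCommGroup A] [Module R A] [AddCommGroup B]
    [Module R B] [AddCommGroup J] [Module R J] (f : A →ₗ[R] B)
    (hf : Function.Injective (f.lTensor J)) (φ : A →ₗ[R] CharacterModule J) :
    ∃ ψ : B →ₗ[R] CharacterModule J, ∀ x, ψ (f x) = φ x := by
  have hf' : Function.Injective (f.rTensor J) := (LinearMap.lTensor_inj_iff_rTensor_inj J f).1 hf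
  obtain ⟨ψ, hψ⟩ := rTensor_injective_iff_lcomp_surjective.1 hf' φ
  exact ⟨ψ, fun x => LinearMap.congr_fun hψ x⟩

lemma injective_characterModule {F : Type u} [AddCommGroup F] [Module R F]
    (hF : Module.Flat R F) : Module.Injective R (CharacterModule F) :=
  Module.Flat.iff_characterModule_injective.1 hF

lemma exists_flat_cover (M : ModuleCat.{u} R) : ∃ (P : ModuleCat.{u} R) (p : P →ₗ[R] M),
    Module.Flat R P ∧ Function.Surjective p := by
  refine ⟨ModuleCat.of R (M →₀ R), Finsupp.linearCombination R id, inferInstance, ?_⟩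
  exact Finsupp.linearCombination_id_surjective R M

lemma subsingleton_ext_flat_characterModule (F : ModuleCat.{u} R) (hF : Module.Flat R F) (n : ℕ)
    (M : ModuleCat.{u} R) :
    Subsingleton (Ext F (ModuleCat.of R (CharacterModule M)) (n + 1)) := by
  induction n generalizing M with
  | zero =>
    obtain ⟨P, p, hP, hp⟩ := exists_flat_cover M
    have h := (IsShortExact.of_ker hp).dual
    refine h.ext_left_one (A := ModuleCat.of R (CharacterModule M))
      (B := ModuleCat.of R (CharacterModule P))
      (C := ModuleCat.of R (CharacterModule (LinearMap.ker p))) (fun φ => ?_)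
      (subsingleton_ext_of_injective _ _ (injective_characterModule hP) 0)
    exact exists_lift_dual _ (Module.Flat.lTensor_preserves_injective_linearMap _
      (Submodule.subtype_injective _)) φ
  | succ n ih =>
    obtain ⟨P, p, hP, hp⟩ := exists_flat_cover M
    have h := (IsShortExact.of_ker hp).dual
    exact h.ext_left_succ (A := ModuleCat.of R (CharacterModule M))
      (B := ModuleCat.of R (CharacterModule P))
      (C := ModuleCat.of R (CharacterModule (LinearMap.ker p)))
      (ih (ModuleCat.of R (LinearMap.ker p)))
      (subsingleton_ext_of_injective _ _ (injective_characterModule hP) (n + 1))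

/-- A class `P` of modules such that every `X ∈ P` is the kernel and the cokernel of maps between
flat modules and members of `P` in short exact sequences which remain exact after tensoring with
injective modules. -/
structure IsGorensteinFlatClass (P : ModuleCat.{u} R → Prop) : Prop where
  left : ∀ X, P X → ∃ (A F : ModuleCat.{u} R) (f : A →ₗ[R] F) (g : F →ₗ[R] X),
    IsShortExact f g ∧ Module.Flat R F ∧ P A ∧
    ∀ J : ModuleCat.{u} R, Module.Injective R J → Function.Injective (f.lTensor J)
  right : ∀ X, P X → ∃ (F C : ModuleCat.{u} R) (f : X →ₗ[R] F) (g : F →ₗ[R] C),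
    IsShortExact f g ∧ Module.Flat R F ∧ P C ∧
    ∀ J : ModuleCat.{u} R, Module.Injective R J → Function.Injective (f.lTensor J)

lemma IsShortExact.congr_left {A A' B C : Type u} [AddCommGroup A] [Module R A]
    [AddCommGroup A'] [Module R A'] [AddCommGroup B] [Module R B] [AddCommGroup C] [Module R C]
    {f : A →ₗ[R] B} {g : B →ₗ[R] C} (h : IsShortExact f g) (e : A' ≃ₗ[R] A) :
    IsShortExact (f ∘ₗ e.toLinearMap) g := by
  refine ⟨h.inj.comp e.injective, h.surj, fun b => (h.exact b).trans ?_⟩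
  exact ⟨fun ⟨a, ha⟩ => ⟨e.symm a, by simp [ha]⟩, fun ⟨a, ha⟩ => ⟨e a, ha⟩⟩

lemma IsShortExact.congr_right {A B C C' : Type u} [AddCommGroup A] [Module R A]
    [AddCommGroup B] [Module R B] [AddCommGroup C] [Module R C] [AddCommGroup C'] [Module R C']
    {f : A →ₗ[R] B} {g : B →ₗ[R] C} (h : IsShortExact f g) (e : C ≃ₗ[R] C') :
    IsShortExact f (e.toLinearMap ∘ₗ g) := by
  refine ⟨h.inj, e.surjective.comp h.surj, fun b => ?_⟩
  rw [← h.exact b]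
  simp

lemma IsGorensteinFlat.exists_class {G : ModuleCat.{u} R} (hG : IsGorensteinFlat R G) :
    ∃ P : ModuleCat.{u} R → Prop, IsGorensteinFlatClass P ∧ P G := by
  obtain ⟨F, d, hF, hd, ⟨e⟩, hJ⟩ := hG
  have hses : ∀ i, IsShortExact (LinearMap.range (d i)).subtype (d (i + 1)).rangeRestrict :=
    fun i => ⟨Submodule.subtype_injective _, LinearMap.surjective_rangeRestrict _, by
      rw [LinearMap.exact_iff, LinearMap.ker_rangeRestrict, Submodule.range_subtype, hd]⟩
  have hten : ∀ (i : ℤ) (J : ModuleCat.{u} R), Module.Injective R J →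
      Function.Injective ((LinearMap.range (d i)).subtype.lTensor J) := by
    intro i J hJi
    obtain ⟨i, rfl⟩ : ∃ j, i = j + 1 := ⟨i - 1, by ring⟩
    rw [injective_iff_map_eq_zero]
    intro x hx
    obtain ⟨y, rfl⟩ := LinearMap.lTensor_surjective J
      (LinearMap.surjective_rangeRestrict (d (i + 1))) x
    have hy : y ∈ LinearMap.ker ((d (i + 1)).lTensor J) := by
      rw [← LinearMap.comp_apply, ← LinearMap.lTensor_comp] at hx
      exact hx
    rw [← hJ J hJi] at hy
    obtain ⟨z, rfl⟩ := hy
    rw [← LinearMap.comp_apply, ← LinearMap.lTensor_comp]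
    have : (d (i + 1)).rangeRestrict ∘ₗ d i = 0 := by
      ext w
      exact LinearMap.mem_ker.1 ((hd i).le ⟨w, rfl⟩)
    rw [this, LinearMap.lTensor_zero, LinearMap.zero_apply]
  refine ⟨fun X => ∃ i, Nonempty (X ≃ₗ[R] LinearMap.range (d i)), ⟨?_, ?_⟩, 0, ⟨e⟩⟩
  · rintro X ⟨i, ⟨e⟩⟩
    obtain ⟨i, rfl⟩ : ∃ j, i = j + 1 := ⟨i - 1, by ring⟩
    exact ⟨ModuleCat.of R (LinearMap.range (d i)), F (i + 1), _, _,
      (hses i).congr_right e.symm, hF _, ⟨i, ⟨LinearEquiv.refl R _⟩⟩, hten i⟩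
  · rintro X ⟨i, ⟨e⟩⟩
    refine ⟨F (i + 1), ModuleCat.of R (LinearMap.range (d (i + 1))), _, _,
      (hses i).congr_left e, hF _, ⟨i + 1, ⟨LinearEquiv.refl R _⟩⟩, fun J hJi => ?_⟩
    rw [LinearMap.lTensor_comp]
    exact (hten i J hJi).comp (e.lTensor J).injective

lemma IsGorensteinFlat.gInj_characterModule {G : ModuleCat.{u} R} (hG : IsGorensteinFlat R G) :
    GInj (ModuleCat.of R (CharacterModule G)) := by
  obtain ⟨P, hP, hPG⟩ := hG.exists_class
  refine ⟨fun Y => ∃ X, P X ∧ Y = ModuleCat.of R (CharacterModule X), ⟨?_, ?_, ?_⟩, G, hPG, rfl⟩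
  · rintro _ ⟨X, hX, rfl⟩ J hJ
    obtain ⟨A, F, f, g, h, hF, -, hf⟩ := hP.left X hX
    exact h.dual.ext_left_one (A := ModuleCat.of R (CharacterModule X))
      (B := ModuleCat.of R (CharacterModule F)) (C := ModuleCat.of R (CharacterModule A))
      (exists_lift_dual f (hf J hJ))
      (subsingleton_ext_of_injective _ _ (injective_characterModule hF) 0)
  · rintro _ ⟨X, hX, rfl⟩
    obtain ⟨F, C, f, g, h, hF, hC, -⟩ := hP.right X hX
    exact ⟨ModuleCat.of R (CharacterModule C), ModuleCat.of R (CharacterModule F), _, _, h.dual,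
      injective_characterModule hF, C, hC, rfl⟩
  · rintro _ ⟨X, hX, rfl⟩
    obtain ⟨A, F, f, g, h, hF, hA, -⟩ := hP.left X hX
    exact ⟨ModuleCat.of R (CharacterModule F), ModuleCat.of R (CharacterModule A), _, _, h.dual,
      injective_characterModule hF, A, hA, rfl⟩

lemma IsGorensteinFlat.subsingleton_ext {G : ModuleCat.{u} R} (hG : IsGorensteinFlat R G)
    {J : ModuleCat.{u} R} (hJ : Module.Injective R J) (n : ℕ) :
    Subsingleton (Ext G (ModuleCat.of R (CharacterModule J)) (n + 1)) := by
  obtain ⟨P, hP, hPG⟩ := hG.exists_class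
  clear hG
  induction n generalizing G with
  | zero =>
    obtain ⟨A, F, f, g, h, hF, -, hf⟩ := hP.left G hPG
    exact h.ext_right_one (exists_extension_dual f (hf J hJ))
      (subsingleton_ext_flat_characterModule F hF 0 J)
  | succ n ih =>
    obtain ⟨A, F, f, g, h, hF, hA, -⟩ := hP.left G hPG
    exact h.ext_right_succ (ih hA) (subsingleton_ext_flat_characterModule F hF (n + 1) J)

lemma subsingleton_ext_of_gorensteinFlatDimLEAux {J : ModuleCat.{u} R}
    (hJ : Module.Injective R J) {n : ℕ} {W : ModuleCat.{u} R}
    (hW : gorensteinFlatDimLEAux R n W) :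
    Subsingleton (Ext W (ModuleCat.of R (CharacterModule J)) (n + 1)) := by
  induction n generalizing W with
  | zero => exact IsGorensteinFlat.subsingleton_ext hW hJ 0
  | succ n ih =>
    obtain ⟨G, f, hf, hG, hK⟩ := hW
    exact (IsShortExact.of_ker hf).ext_right_succ (A := ModuleCat.of R (LinearMap.ker f)) (ih hK)
      (hG.subsingleton_ext hJ (n + 1))

lemma gInjDimLE_of_gorensteinFlatDimLEAux {n : ℕ} {M : ModuleCat.{u} R}
    (hM : gorensteinFlatDimLEAux R n M) : GInjDimLE n (ModuleCat.of R (CharacterModule M)) := by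
  induction n generalizing M with
  | zero => exact IsGorensteinFlat.gInj_characterModule hM
  | succ n ih =>
    obtain ⟨G, f, hf, hG, hK⟩ := hM
    exact ⟨ModuleCat.of R (CharacterModule G),
      ModuleCat.of R (CharacterModule (LinearMap.ker f)), _, _, (IsShortExact.of_ker hf).dual,
      hG.gInj_characterModule, ih hK⟩

lemma flatDimLEAux_of_gInjDimLE {n : ℕ} {M : ModuleCat.{u} R}
    (hM : GInjDimLE n (ModuleCat.of R (CharacterModule M)))
    (hE : ∀ W : ModuleCat.{u} R, GInj W →
      Subsingleton (Ext W (ModuleCat.of R (CharacterModule M)) (n + 1))) :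
    flatDimLEAux R n M := by
  induction n generalizing M with
  | zero =>
    obtain ⟨E, W, f, g, h, hinj, hW⟩ := isGorensteinInjectiveClass_gInj.right _ hM
    obtain ⟨s, hs⟩ := h.exists_lift_of_ext (hE W hW) LinearMap.id
    obtain ⟨r, hr⟩ := h.exists_lift (LinearMap.id - s ∘ₗ g) (fun x => by simp [hs])
    refine Module.Flat.iff_characterModule_injective.2 (hinj.of_retract f r fun m => h.inj ?_)
    rw [hr]
    simp [h.apply_apply]
  | succ n ih =>
    obtain ⟨P, p, hP, hp⟩ := exists_flat_cover M
    have h := (IsShortExact.of_ker hp).dual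
    exact ⟨P, p, hp, hP, ih (M := ModuleCat.of R (LinearMap.ker p))
      (hM.cosyzygy (A := ModuleCat.of R (CharacterModule M))
        (E := ModuleCat.of R (CharacterModule P))
        (A' := ModuleCat.of R (CharacterModule (LinearMap.ker p))) h
        (injective_characterModule hP))
      fun W hW => h.ext_right (A := ModuleCat.of R (CharacterModule M))
        (B := ModuleCat.of R (CharacterModule P))
        (C := ModuleCat.of R (CharacterModule (LinearMap.ker p))) (hE W hW)
        (subsingleton_ext_of_injective _ _ (injective_characterModule hP) n)⟩

end GorensteinFlat

/-- If every Gorenstein injective `R`-module has Gorenstein flat dimension at most `n`,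
then every injective `R`-module has flat dimension at most `n`. -/
theorem injective_flatDim_le_of_gorensteinInjective_gorensteinFlatDim_le
    (R : Type u) [CommRing R] (n : ℕ)
    (h : ∀ (M : Type u) [AddCommGroup M] [Module R M],
      IsGorensteinInjective R M → GorensteinFlatDimLE R n M) :
    ∀ (I : Type u) [AddCommGroup I] [Module R I],
      Module.Injective R I → FlatDimLE R n I := by
  intro I _ _ hI
  exact flatDimLEAux_of_gInjDimLE
    (gInjDimLE_of_gorensteinFlatDimLEAux
      (h I (gInj_of_injective (X := ModuleCat.of R I) hI).isGorensteinInjective))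
    fun W hW => subsingleton_ext_of_gorensteinFlatDimLEAux (J := ModuleCat.of R I) hI
      (h W hW.isGorensteinInjective)
end

section
/- The ring R = K[X]/(X²), for K a field, is a local Gorenstein semisimple (hence Gorenstein Von Neumann regular) commutative ring that is not a field; in particular, every R-module is Gorenstein projective and every R-module is Gorenstein flat, yet R is not a field. -/
universe u

open TensorProduct

/-- A `K`-algebra structure of dual numbers on `R`: an element `x` of square zero together with a
`K`-linear functional `coord` such that every `r` is `coord (x * r) + coord r * x`. -/
structure DualNumberData (K R : Type*) [CommRing K] [CommRing R] [Algebra K R] where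
  x : R
  x_mul_x : x * x = 0
  coord : R →ₗ[K] K
  coord_one : coord 1 = 0
  coord_x : coord x = 1
  decomp : ∀ r, x * algebraMap K R (coord r) + algebraMap K R (coord (x * r)) = r

namespace DualNumberData

section Ring

variable {K R : Type*} [Field K] [CommRing R] [Algebra K R]

theorem nontrivial (D : DualNumberData K R) : Nontrivial R := by
  refine nontrivial_of_ne D.x 0 fun h => ?_
  have := D.coord_x
  simp [h] at this

theorem isNilpotent_x (D : DualNumberData K R) : IsNilpotent D.x := ⟨2, by rw [pow_two, D.x_mul_x]⟩

theorem isLocalRing (D : DualNumberData K R) : IsLocalRing R := by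
  have := D.nontrivial
  refine IsLocalRing.of_isUnit_or_isUnit_one_sub_self fun r => ?_
  have hnil : IsNilpotent (D.x * algebraMap K R (D.coord r)) :=
    (Commute.all _ _).isNilpotent_mul_right D.isNilpotent_x
  have hr := D.decomp r
  by_cases ha : D.coord (D.x * r) = 0
  · right
    rw [ha, map_zero, add_zero] at hr
    rw [hr] at hnil
    exact hnil.isUnit_one_sub
  · left
    rw [← hr]
    exact hnil.isUnit_add_right_of_commute ((isUnit_iff_ne_zero.mpr ha).map _) (Commute.all _ _)

theorem not_isField (D : DualNumberData K R) : ¬ IsField R := by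
  intro hR
  have := hR.isDomain
  have hx : D.x = 0 := mul_self_eq_zero.mp D.x_mul_x
  have := D.coord_x
  simp [hx] at this

end Ring

section Module

variable {K R : Type*} [CommRing K] [CommRing R] [Algebra K R] (D : DualNumberData K R)

/-- The `K`-linear endomorphism `r ↦ coord r` of `R`, a contracting homotopy for multiplication
by `x`. -/
def homotopy : R →ₗ[K] R := Algebra.linearMap K R ∘ₗ D.coord

theorem homotopy_spec (r : R) : D.x * D.homotopy r + D.homotopy (D.x * r) = r := D.decomp r

theorem exists_homotopy_of_projective (Q : Type*) [AddCommGroup Q] [Module R Q] [Module K Q]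
    [IsScalarTower K R Q] [Module.Projective R Q] :
    ∃ h : Q →ₗ[K] Q, ∀ q, D.x • h q + h (D.x • q) = q := by
  obtain ⟨s, hs⟩ := Module.Projective.out (R := R) (P := Q)
  let p := Finsupp.linearCombination R (id : Q → Q)
  let H : (Q →₀ R) →ₗ[K] (Q →₀ R) := Finsupp.mapRange.linearMap D.homotopy
  have hH (v : Q →₀ R) : D.x • H v + H (D.x • v) = v := by
    ext q
    exact D.homotopy_spec (v q)
  refine ⟨p.restrictScalars K ∘ₗ H ∘ₗ s.restrictScalars K, fun q => ?_⟩
  change D.x • p (H (s q)) + p (H (s (D.x • q))) = q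
  rw [← map_smul, map_smul s, ← map_add, hH]
  exact hs q

variable (M : Type*) [AddCommGroup M] [Module R M] [Module K M] [IsScalarTower K R M]

/-- Multiplication by `x ⊗ 1 + ε (1 ⊗ x)` on `R ⊗[K] M`. -/
noncomputable def diff (ε : K) : R ⊗[K] M →ₗ[R] R ⊗[K] M :=
  LinearMap.lsmul R (R ⊗[K] M) D.x +
    LinearMap.baseChange R (ε • (LinearMap.lsmul R M D.x).restrictScalars K)

variable {M}

@[simp]
theorem diff_tmul (ε : K) (r : R) (m : M) :
    D.diff M ε (r ⊗ₜ m) = (D.x * r) ⊗ₜ m + r ⊗ₜ (ε • D.x • m) := by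
  simp [diff, smul_tmul']

theorem smul_x_smul_x {N : Type*} [AddCommGroup N] [Module R N] (n : N) :
    D.x • D.x • n = 0 := by
  rw [smul_smul, D.x_mul_x, zero_smul]

theorem diff_diff_neg (ε : K) (z : R ⊗[K] M) : D.diff M (-ε) (D.diff M ε z) = 0 := by
  induction z with
  | zero => simp
  | add a b ha hb => rw [map_add, map_add, ha, hb, add_zero]
  | tmul r m =>
    simp [← mul_assoc, D.x_mul_x, D.smul_x_smul_x, tmul_neg]

theorem eq_diff_neg_homotopy (ε : K) (z : R ⊗[K] M) :
    D.diff M (-ε) (D.homotopy.rTensor M z) + D.homotopy.rTensor M (D.diff M ε z) = z := by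
  induction z with
  | zero => simp
  | add a b ha hb =>
    simp only [map_add]
    nth_rw 3 [← ha, ← hb]
    abel
  | tmul r m =>
    simp only [LinearMap.rTensor_tmul, diff_tmul, map_add]
    nth_rw 5 [← D.homotopy_spec r]
    rw [add_tmul, neg_smul, tmul_neg]
    abel

theorem range_diff (ε : K) :
    LinearMap.range (D.diff M ε) = LinearMap.ker (D.diff M (-ε)) := by
  refine le_antisymm ?_ fun z hz => ?_
  · rintro _ ⟨z, rfl⟩
    exact D.diff_diff_neg ε z
  · have h := D.eq_diff_neg_homotopy (-ε) z
    rw [LinearMap.mem_ker.mp hz, map_zero, add_zero, neg_neg] at h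
    exact ⟨_, h⟩

variable (M) in
/-- The embedding `m ↦ x ⊗ m + 1 ⊗ x m` of a module into an induced one. -/
noncomputable def embedding : M →ₗ[R] R ⊗[K] M where
  toFun m := D.x ⊗ₜ m + 1 ⊗ₜ (D.x • m)
  map_add' a b := by
    simp only [smul_add, tmul_add]
    abel
  map_smul' r m := by
    have key (c : K) (n : M) : (algebraMap K R c) • n = c • n := algebraMap_smul R c n
    simp only [RingHom.id_apply, smul_add, smul_tmul', smul_eq_mul, mul_one]
    obtain ⟨a, b, rfl⟩ : ∃ a b : K, r = D.x * algebraMap K R a + algebraMap K R b :=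
      ⟨_, _, (D.decomp r).symm⟩
    have h1 : (D.x * algebraMap K R a + algebraMap K R b) • m = a • D.x • m + b • m := by
      rw [add_smul, mul_comm, mul_smul, key, key]
    have h2 : D.x • (a • D.x • m + b • m) = b • D.x • m := by
      rw [smul_add, smul_comm D.x a, D.smul_x_smul_x, smul_zero, zero_add, smul_comm]
    have h3 : (D.x * algebraMap K R a + algebraMap K R b) * D.x = b • D.x := by
      rw [add_mul, mul_right_comm, D.x_mul_x, zero_mul, zero_add, Algebra.smul_def]
    have h4 : D.x * algebraMap K R a + algebraMap K R b = a • D.x + b • (1 : R) := by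
      simp [Algebra.smul_def, mul_comm]
    rw [h1, h2, h3, h4]
    simp only [add_tmul, tmul_add, tmul_smul, ← smul_tmul']
    abel

theorem embedding_injective : Function.Injective (D.embedding M) := by
  refine Function.LeftInverse.injective
    (g := TensorProduct.lift (LinearMap.lsmul K M ∘ₗ D.coord)) fun m => ?_
  simp [embedding, D.coord_x, D.coord_one]

theorem range_diff_one : LinearMap.range (D.diff M 1) = LinearMap.range (D.embedding M) := by
  let μ : R ⊗[K] M →ₗ[R] M := LinearMap.liftBaseChange R LinearMap.id
  have hμ : Function.Surjective μ := fun m => ⟨1 ⊗ₜ m, by simp [μ]⟩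
  have h : D.diff M 1 = D.embedding M ∘ₗ μ := by
    ext m
    simp [μ, embedding]
  rw [h, LinearMap.range_comp_of_range_eq_top _ (LinearMap.range_eq_top.mpr hμ)]

variable (M) in
/-- A module is the range of `x ⊗ 1 + 1 ⊗ x` on the module it induces. -/
noncomputable def equivRangeDiff (i : ℤ) (hi : i.negOnePow = 1) :
    M ≃ₗ[R] LinearMap.range (D.diff M (i.negOnePow : ℤ)) :=
  (LinearEquiv.ofInjective _ D.embedding_injective).trans
    (LinearEquiv.ofEq _ _ (by rw [← D.range_diff_one, hi]; simp))

end Module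

section Gorenstein

variable {K R : Type u} [Field K] [CommRing R] [Algebra K R]

theorem exists_eq_comp_diff (D : DualNumberData K R) (M Q : Type*)
    [AddCommGroup M] [Module R M] [Module K M] [IsScalarTower K R M]
    [AddCommGroup Q] [Module R Q] [Module.Projective R Q] (ε : K)
    (f : R ⊗[K] M →ₗ[R] Q) (hf : f ∘ₗ D.diff M ε = 0) :
    ∃ g : R ⊗[K] M →ₗ[R] Q, f = g ∘ₗ D.diff M (-ε) := by
  let := Module.compHom Q (algebraMap K R)
  have : IsScalarTower K R Q := .of_algebraMap_smul fun _ _ => rfl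
  obtain ⟨h, hh⟩ := D.exists_homotopy_of_projective Q
  let φ : M →ₗ[K] Q := f.restrictScalars K ∘ₗ TensorProduct.mk K R M 1
  let g : R ⊗[K] M →ₗ[R] Q := LinearMap.liftBaseChange R (h ∘ₗ φ)
  refine ⟨g, ?_⟩
  ext m
  have hm : D.x • φ m + ε • φ (D.x • m) = 0 := by
    have := LinearMap.congr_fun hf (1 ⊗ₜ m)
    have hx : f (D.x ⊗ₜ m) = D.x • f (1 ⊗ₜ m) := by
      rw [← map_smul, smul_tmul', smul_eq_mul, mul_one]
    simpa [hx, φ] using this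
  have hφ : ε • φ (D.x • m) = -(D.x • φ m) := eq_neg_of_add_eq_zero_right hm
  have hg (n : M) : g (1 ⊗ₜ n) = h (φ n) := by simp [g]
  have hd : D.diff M (-ε) (1 ⊗ₜ m) = D.x • (1 ⊗ₜ m) + 1 ⊗ₜ (-ε • D.x • m) := by
    simp [smul_tmul']
  change φ m = g (D.diff M (-ε) (1 ⊗ₜ m))
  rw [hd, map_add, map_smul, hg, hg, neg_smul, map_neg, map_smul φ, hφ, neg_neg, hh]

theorem projective_of_injective (D : DualNumberData K R) (I : Type u)
    [AddCommGroup I] [Module R I] [Module.Injective R I] : Module.Projective R I := by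
  let := Module.compHom I (algebraMap K R)
  have : IsScalarTower K R I := .of_algebraMap_smul fun _ _ => rfl
  obtain ⟨p, hp⟩ := Module.Injective.out (D.embedding I) D.embedding_injective LinearMap.id
  exact Module.Projective.of_split (D.embedding I) p (LinearMap.ext hp)

theorem range_diff_negOnePow (D : DualNumberData K R) (M : Type*)
    [AddCommGroup M] [Module R M] [Module K M] [IsScalarTower K R M] (i : ℤ) :
    LinearMap.range (D.diff M (i.negOnePow : ℤ)) =
      LinearMap.ker (D.diff M ((i + 1).negOnePow : ℤ)) := by
  rw [D.range_diff, Int.negOnePow_succ]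
  simp

variable (M : Type u) [AddCommGroup M] [Module R M]

theorem isGorensteinProjective (D : DualNumberData K R) : IsGorensteinProjective R M := by
  let := Module.compHom M (algebraMap K R)
  have : IsScalarTower K R M := .of_algebraMap_smul fun _ _ => rfl
  refine ⟨fun _ => .of R (R ⊗[K] M), fun i => D.diff M (i.negOnePow : ℤ),
    fun _ => inferInstanceAs (Module.Projective R (R ⊗[K] M)), D.range_diff_negOnePow M, ?_, ?_⟩
  · exact ⟨D.equivRangeDiff M 0 Int.negOnePow_zero⟩
  · intro Q hQ i f hf
    obtain ⟨g, hg⟩ := D.exists_eq_comp_diff M Q _ f hf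
    refine ⟨g, ?_⟩
    simpa [Int.negOnePow_succ] using hg

theorem isGorensteinFlat (D : DualNumberData K R) : IsGorensteinFlat R M := by
  let := Module.compHom M (algebraMap K R)
  have : IsScalarTower K R M := .of_algebraMap_smul fun _ _ => rfl
  refine ⟨fun _ => .of R (R ⊗[K] M), fun i => D.diff M (i.negOnePow : ℤ),
    fun _ => inferInstanceAs (Module.Flat R (R ⊗[K] M)), D.range_diff_negOnePow M, ?_, ?_⟩
  · exact ⟨D.equivRangeDiff M 0 Int.negOnePow_zero⟩
  · intro I hI i
    have := D.projective_of_injective I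
    exact (Module.Flat.lTensor_exact I
      (LinearMap.exact_iff.mpr (D.range_diff_negOnePow M i).symm)).linearMap_ker_eq.symm

end Gorenstein

end DualNumberData

open Polynomial in
/-- The dual number structure on `K[X]/(X²)`. -/
noncomputable def dualNumberDataQuotientXSq (K : Type*) [Field K] :
    DualNumberData K (K[X] ⧸ Ideal.span {(X : K[X]) ^ 2}) where
  x := Ideal.Quotient.mk _ X
  x_mul_x := by
    rw [← map_mul, ← pow_two, Ideal.Quotient.eq_zero_iff_mem]
    exact Ideal.mem_span_singleton_self _
  coord := Submodule.liftQ ((Ideal.span {(X : K[X]) ^ 2}).restrictScalars K) (lcoeff K 1) (by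
      intro p hp
      exact X_pow_dvd_iff.mp (Ideal.mem_span_singleton.mp hp) 1 one_lt_two) ∘ₗ
    (Submodule.Quotient.restrictScalarsEquiv K (Ideal.span {(X : K[X]) ^ 2})).symm.toLinearMap
  coord_one := (coeff_one (R := K) (n := 1)).trans (by simp)
  coord_x := coeff_X_one
  decomp r := by
    obtain ⟨p, rfl⟩ := Ideal.Quotient.mk_surjective r
    change Ideal.Quotient.mk _ X * Ideal.Quotient.mk _ (C (p.coeff 1)) +
      Ideal.Quotient.mk _ (C ((X * p).coeff 1)) = _
    rw [← map_mul, ← map_add, Ideal.Quotient.eq, Ideal.mem_span_singleton, X_pow_dvd_iff]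
    intro d hd
    interval_cases d <;> simp [coeff_C]

/-- `K[X]/(X²)`, for `K` a field, is a local Gorenstein semisimple (hence Gorenstein Von
Neumann regular) commutative ring which is not a field. -/
theorem kxModXsq_local_gorensteinSemisimple_not_field (K : Type u) [Field K] :
    IsLocalRing (Polynomial K ⧸ Ideal.span {(Polynomial.X : Polynomial K) ^ 2}) ∧
    (∀ (M : Type u) [AddCommGroup M]
        [Module (Polynomial K ⧸ Ideal.span {(Polynomial.X : Polynomial K) ^ 2}) M],
      IsGorensteinProjective (Polynomial K ⧸ Ideal.span {(Polynomial.X : Polynomial K) ^ 2}) M) ∧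
    (∀ (M : Type u) [AddCommGroup M]
        [Module (Polynomial K ⧸ Ideal.span {(Polynomial.X : Polynomial K) ^ 2}) M],
      IsGorensteinFlat (Polynomial K ⧸ Ideal.span {(Polynomial.X : Polynomial K) ^ 2}) M) ∧
    ¬ IsField (Polynomial K ⧸ Ideal.span {(Polynomial.X : Polynomial K) ^ 2}) := by
  exact ⟨(dualNumberDataQuotientXSq K).isLocalRing,
    fun M _ _ => (dualNumberDataQuotientXSq K).isGorensteinProjective M,
    fun M _ _ => (dualNumberDataQuotientXSq K).isGorensteinFlat M,
    (dualNumberDataQuotientXSq K).not_isField⟩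
end
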